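/- arXiv:1512.00365 — 7 statements merged into one kernel-verified Lean document; each statement's English description precedes it below -/
import Mathlib

section
/- For every T ∈ Inc^q(λ), the jeu-de-taquin form of K-promotion applied to T equals kbk_{q−1} ∘ ⋯ ∘ kbk_1 (T), the composition of the K-Bender-Knuth involutions applied in order kbk_1 first. -/
open scoped Classical

/-- Two cells of `ℕ × ℕ` are horizontally or vertically adjacent. -/
def incAdj (c d : ℕ × ℕ) : Prop :=
  (c.1 = d.1 ∧ (c.2 + 1 = d.2 ∨ d.2 + 1 = c.2)) ∨
  (c.2 = d.2 ∧ (c.1 + 1 = d.1 ∨ d.1 + 1 = c.1))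

/-- `T` is an increasing tableau on the cell set `μ` with entries in `{1,…,q}`:
entries strictly increase along rows and down columns. -/
def IsIncTab (μ : Finset (ℕ × ℕ)) (q : ℕ) (T : ℕ × ℕ → ℕ) : Prop :=
  (∀ c ∈ μ, 1 ≤ T c ∧ T c ≤ q) ∧
  (∀ c ∈ μ, ∀ d ∈ μ, c.1 = d.1 → c.2 < d.2 → T c < T d) ∧
  (∀ c ∈ μ, ∀ d ∈ μ, c.2 = d.2 → c.1 < d.1 → T c < T d)

/-- The `i`-th K-Bender-Knuth involution: every entry `i` with no adjacent cell
containing `i+1` becomes `i+1`, and every entry `i+1` with no adjacent cell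
containing `i` becomes `i`. -/
noncomputable def kbkMap (μ : Finset (ℕ × ℕ)) (i : ℕ) (T : ℕ × ℕ → ℕ) : ℕ × ℕ → ℕ :=
  fun c =>
    if c ∈ μ ∧ T c = i ∧ ¬ ∃ d ∈ μ, incAdj c d ∧ T d = i + 1 then i + 1
    else if c ∈ μ ∧ T c = i + 1 ∧ ¬ ∃ d ∈ μ, incAdj c d ∧ T d = i then i
    else T c

/-- K-promotion `∂ = kbk_{q-1} ∘ ⋯ ∘ kbk_1` (with `kbk_1` applied first). -/
noncomputable def kPromo (μ : Finset (ℕ × ℕ)) (q : ℕ) (T : ℕ × ℕ → ℕ) : ℕ × ℕ → ℕ :=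
  (List.range (q - 1)).foldl (fun S k => kbkMap μ (k + 1) S) T

/-- One step of the jeu-de-taquin form of K-promotion, for the value `i`:
empty cells are encoded by `0`.  Consider the set `S` of cells of `μ` that are
empty or contain `i`; in every connected component (via horizontal/vertical
adjacency within `S`) containing more than one cell, each entry `i` is deleted
and each empty cell receives the entry `i`; singleton components are unchanged. -/
noncomputable def jdtStep (μ : Finset (ℕ × ℕ)) (i : ℕ) (U : ℕ × ℕ → ℕ) : ℕ × ℕ → ℕ :=
  fun c =>
    if (c ∈ μ ∧ (U c = 0 ∨ U c = i)) ∧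
        ∃ d, d ≠ c ∧ (d ∈ μ ∧ (U d = 0 ∨ U d = i)) ∧
          Relation.ReflTransGen
            (fun x y => incAdj x y ∧ (x ∈ μ ∧ (U x = 0 ∨ U x = i)) ∧
              (y ∈ μ ∧ (U y = 0 ∨ U y = i))) c d
    then (if U c = i then 0 else i)
    else U c

/-- The jeu-de-taquin form of K-promotion: delete all entries `1` (making those
cells empty, encoded by `0`), perform the short-ribbon swapping steps for
`i = 2, 3, …, q` in order, then write `q+1` in every remaining empty cell and
subtract `1` from every entry. -/
noncomputable def kPromoJdt (μ : Finset (ℕ × ℕ)) (q : ℕ) (T : ℕ × ℕ → ℕ) : ℕ × ℕ → ℕ :=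
  let U0 : ℕ × ℕ → ℕ := fun c => if c ∈ μ ∧ T c = 1 then 0 else T c
  let U : ℕ × ℕ → ℕ := (List.range (q - 1)).foldl (fun V k => jdtStep μ (k + 2) V) U0
  fun c => if c ∈ μ then (if U c = 0 then q else U c - 1) else U c

/-- The first cell lies immediately to the left of, or immediately above, the second. -/
def incCov (c d : ℕ × ℕ) : Prop :=
  (c.1 = d.1 ∧ c.2 + 1 = d.2) ∨ (c.2 = d.2 ∧ c.1 + 1 = d.1)

theorem incAdj_iff_cov (c d : ℕ × ℕ) : incAdj c d ↔ incCov c d ∨ incCov d c := by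
  unfold incAdj incCov
  constructor <;> intro h <;> omega

/-- Local strictness along covers. -/
def LocInc (μ : Finset (ℕ × ℕ)) (S : ℕ × ℕ → ℕ) : Prop :=
  ∀ c ∈ μ, ∀ d ∈ μ, incCov c d → S c < S d

/-- Entries of the Bender-Knuth side from those of the jeu-de-taquin side. -/
def relabel (i u : ℕ) : ℕ := if u = 0 then i else if u ≤ i then u - 1 else u

theorem kbk_locInc (μ : Finset (ℕ × ℕ)) (i : ℕ) (S : ℕ × ℕ → ℕ) (h : LocInc μ S) :
    LocInc μ (kbkMap μ i S) := by
  intro c hc d hd hcd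
  have h0 := h c hc d hd hcd
  have a1 : incAdj c d := (incAdj_iff_cov c d).2 (Or.inl hcd)
  have a2 : incAdj d c := (incAdj_iff_cov d c).2 (Or.inr hcd)
  have e1 : S d = i + 1 → ∃ d ∈ μ, incAdj c d ∧ S d = i + 1 := fun e => ⟨d, hd, a1, e⟩
  have e2 : S c = i → ∃ c ∈ μ, incAdj d c ∧ S c = i := fun e => ⟨c, hc, a2, e⟩
  unfold kbkMap
  split_ifs <;> first | omega | (exfalso; grind) | grind

theorem jdt_cond (μ : Finset (ℕ × ℕ)) (P : ℕ × ℕ → Prop) (c : ℕ × ℕ) :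
    ((c ∈ μ ∧ P c) ∧ ∃ d, d ≠ c ∧ (d ∈ μ ∧ P d) ∧
      Relation.ReflTransGen (fun x y => incAdj x y ∧ (x ∈ μ ∧ P x) ∧ (y ∈ μ ∧ P y)) c d) ↔
    (c ∈ μ ∧ P c) ∧ ∃ d ∈ μ, incAdj c d ∧ P d := by
  constructor
  · rintro ⟨hc, d, hne, hd, hr⟩
    refine ⟨hc, ?_⟩
    rcases Relation.ReflTransGen.cases_head hr with e | ⟨y, hy, -⟩
    · exact absurd e.symm hne
    · exact ⟨y, hy.2.2.1, hy.1, hy.2.2.2⟩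
  · rintro ⟨hc, d, hd, ha, hP⟩
    refine ⟨hc, d, ?_, ⟨hd, hP⟩, Relation.ReflTransGen.single ⟨ha, hc, hd, hP⟩⟩
    rintro rfl
    unfold incAdj at ha
    omega

theorem jdt_step_relabel (μ : Finset (ℕ × ℕ)) (i : ℕ) (hi : 1 ≤ i) (U S : ℕ × ℕ → ℕ)
    (hS : LocInc μ S) (hU : ∀ c ∈ μ, S c = relabel i (U c)) (c : ℕ × ℕ) (hc : c ∈ μ) :
    kbkMap μ i S c = relabel (i + 1) (jdtStep μ (i + 1) U c) := by
  have k0 : ∀ c ∈ μ, (U c = 0 ↔ S c = i) := by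
    intro c hc
    rw [hU c hc]; unfold relabel; split_ifs <;> omega
  have k1 : ∀ c ∈ μ, (U c = i + 1 ↔ S c = i + 1) := by
    intro c hc
    rw [hU c hc]; unfold relabel; split_ifs <;> omega
  have hne : ∀ d ∈ μ, incAdj c d → S c ≠ S d := by
    intro d hd ha
    rcases (incAdj_iff_cov c d).1 ha with h | h
    · exact (hS c hc d hd h).ne
    · exact (hS d hd c hc h).ne'
  have key : (∃ d ∈ μ, incAdj c d ∧ (U d = 0 ∨ U d = i + 1)) ↔
      (∃ d ∈ μ, incAdj c d ∧ S d = i) ∨ (∃ d ∈ μ, incAdj c d ∧ S d = i + 1) := by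
    constructor
    · rintro ⟨d, hd, ha, h | h⟩
      · exact Or.inl ⟨d, hd, ha, (k0 d hd).1 h⟩
      · exact Or.inr ⟨d, hd, ha, (k1 d hd).1 h⟩
    · rintro (⟨d, hd, ha, h⟩ | ⟨d, hd, ha, h⟩)
      · exact ⟨d, hd, ha, Or.inl ((k0 d hd).2 h)⟩
      · exact ⟨d, hd, ha, Or.inr ((k1 d hd).2 h)⟩
  have n0 : S c = i → ¬ ∃ d ∈ μ, incAdj c d ∧ S d = i := by
    rintro e ⟨d, hd, ha, h⟩
    exact hne d hd ha (e.trans h.symm)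
  have n1 : S c = i + 1 → ¬ ∃ d ∈ μ, incAdj c d ∧ S d = i + 1 := by
    rintro e ⟨d, hd, ha, h⟩
    exact hne d hd ha (e.trans h.symm)
  have K0 := k0 c hc
  have K1 := k1 c hc
  have hUc := hU c hc
  unfold kbkMap jdtStep
  rw [if_congr (jdt_cond μ (fun x => U x = 0 ∨ U x = i + 1) c) rfl rfl]
  simp only [key, hc, true_and]
  clear key hne k0 k1 hU hS
  by_cases hA : ∃ d ∈ μ, incAdj c d ∧ S d = i <;>
    by_cases hB : ∃ d ∈ μ, incAdj c d ∧ S d = i + 1 <;>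
    simp only [hA, hB] at n0 n1 ⊢ <;> clear hA hB <;>
    generalize U c = u at * <;> generalize S c = s at * <;>
    unfold relabel at * <;> grind

theorem jdtStep_le (μ : Finset (ℕ × ℕ)) (i q : ℕ) (hi : i ≤ q) (U : ℕ × ℕ → ℕ)
    (c : ℕ × ℕ) (h : U c ≤ q) : jdtStep μ i U c ≤ q := by
  unfold jdtStep
  split_ifs <;> omega

theorem jdt_invariant (μ : Finset (ℕ × ℕ)) (q : ℕ) (T : ℕ × ℕ → ℕ)
    (hT : IsIncTab μ q T) (n : ℕ) (hn : n + 1 ≤ q) :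
    LocInc μ ((List.range n).foldl (fun S k => kbkMap μ (k + 1) S) T) ∧
    (∀ c ∈ μ, (List.range n).foldl (fun S k => kbkMap μ (k + 1) S) T c =
      relabel (n + 1) ((List.range n).foldl (fun V k => jdtStep μ (k + 2) V)
        (fun c => if c ∈ μ ∧ T c = 1 then 0 else T c) c)) ∧
    (∀ c ∈ μ, (List.range n).foldl (fun V k => jdtStep μ (k + 2) V)
        (fun c => if c ∈ μ ∧ T c = 1 then 0 else T c) c ≤ q) ∧
    (∀ c ∉ μ, (List.range n).foldl (fun V k => jdtStep μ (k + 2) V)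
        (fun c => if c ∈ μ ∧ T c = 1 then 0 else T c) c =
      (List.range n).foldl (fun S k => kbkMap μ (k + 1) S) T c) := by
  induction n with
  | zero =>
    simp only [List.range_zero, List.foldl_nil]
    refine ⟨?_, ?_, ?_, ?_⟩
    · intro c hc d hd h
      rcases h with ⟨h1, h2⟩ | ⟨h1, h2⟩
      · exact hT.2.1 c hc d hd h1 (by omega)
      · exact hT.2.2 c hc d hd h1 (by omega)
    · intro c hc
      have := hT.1 c hc
      unfold relabel
      simp only [hc, true_and]
      split_ifs <;> omega
    · intro c hc
      have := hT.1 c hc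
      split_ifs <;> omega
    · intro c hc
      simp [hc]
  | succ n ih =>
    obtain ⟨h1, h2, h3, h4⟩ := ih (by omega)
    simp only [List.range_succ, List.foldl_append, List.foldl_cons, List.foldl_nil]
    refine ⟨kbk_locInc _ _ _ h1, jdt_step_relabel μ (n + 1) (by omega) _ _ h1 h2, ?_, ?_⟩
    · intro c hc
      exact jdtStep_le μ (n + 2) q (by omega) _ c (h3 c hc)
    · intro c hc
      have := h4 c hc
      simpa [jdtStep, kbkMap, hc] using this

/-- Proposition 2.4: the jeu-de-taquin form of K-promotion coincides with the
composition `kbk_{q-1} ∘ ⋯ ∘ kbk_1` of K-Bender-Knuth involutions. -/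
theorem kPromoJdt_eq_kbk_composition (Y : YoungDiagram) (q : ℕ) (hq : 0 < q)
    (T : ℕ × ℕ → ℕ) (hT : IsIncTab Y.cells q T) :
    kPromoJdt Y.cells q T = kPromo Y.cells q T := by
  obtain ⟨-, h2, h3, h4⟩ := jdt_invariant Y.cells q T hT (q - 1) (by omega)
  funext c
  unfold kPromoJdt kPromo
  by_cases hc : c ∈ Y.cells
  · have e := h2 c hc
    have b := h3 c hc
    rw [e]
    simp only [hc, if_true]
    unfold relabel
    have hq1 : q - 1 + 1 = q := by omega
    rw [hq1, if_pos b]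
  · have e := h4 c hc
    simp only [hc, if_false]
    exact e
end

section
/- Let T ∈ Inc^q(a×b) and suppose i ∈ {1,…,q} is a descent of T. Then i−1 (if i ≥ 2), respectively q (if i = 1), is a descent of ∂(T). -/
open scoped Classical

/-- The cells of the rectangular shape `a × b` (rows `0,…,a-1`, columns `0,…,b-1`). -/
def rectCells (a b : ℕ) : Finset (ℕ × ℕ) := Finset.range a ×ˢ Finset.range b

/-- For `i < q`: some entry `i` occurs in a strictly higher row than some entry `i+1`. -/
def DescentAt (a b : ℕ) (T : ℕ × ℕ → ℕ) (i : ℕ) : Prop :=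
  ∃ c ∈ rectCells a b, ∃ d ∈ rectCells a b, T c = i ∧ T d = i + 1 ∧ c.1 < d.1

/-- `i` is a descent of `T ∈ Inc^q(a×b)`: for `i < q` this means some entry `i`
occurs in a row of strictly smaller index than some entry `i+1`; `q` is a
descent of `T` iff `q-1` is a descent of `∂(T)`. -/
noncomputable def IsDescent (a b q : ℕ) (T : ℕ × ℕ → ℕ) (i : ℕ) : Prop :=
  if i = q then DescentAt a b (kPromo (rectCells a b) q T) (q - 1) else DescentAt a b T i

/-- For `i < q`: some entry `i` occurs in a strictly smaller-indexed column than
some entry `i+1`. -/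
def TDescentAt (a b : ℕ) (T : ℕ × ℕ → ℕ) (i : ℕ) : Prop :=
  ∃ c ∈ rectCells a b, ∃ d ∈ rectCells a b, T c = i ∧ T d = i + 1 ∧ c.2 < d.2

/-- `i` is a transpose descent of `T ∈ Inc^q(a×b)`: for `i < q` this means some
entry `i` occurs in a column of strictly smaller index than some entry `i+1`;
`q` is a transpose descent of `T` iff `q-1` is a transpose descent of `∂(T)`. -/
noncomputable def IsTDescent (a b q : ℕ) (T : ℕ × ℕ → ℕ) (i : ℕ) : Prop :=
  if i = q then TDescentAt a b (kPromo (rectCells a b) q T) (q - 1) else TDescentAt a b T i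

namespace DS

def Inc (a b : ℕ) (T : ℕ × ℕ → ℕ) : Prop :=
  (∀ r s, r < a → s + 1 < b → T (r, s) < T (r, s + 1)) ∧
  (∀ r s, r + 1 < a → s < b → T (r, s) < T (r + 1, s))

def Bd (a b q : ℕ) (T : ℕ × ℕ → ℕ) : Prop :=
  ∀ r s, r < a → s < b → 1 ≤ T (r, s) ∧ T (r, s) ≤ q

/-- some cell adjacent to `(r,s)` contains `v`. -/
def HA (a b : ℕ) (T : ℕ × ℕ → ℕ) (r s v : ℕ) : Prop :=
  ∃ d ∈ rectCells a b, incAdj (r, s) d ∧ T d = v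

lemma mem_rect {a b r s : ℕ} : (r, s) ∈ rectCells a b ↔ r < a ∧ s < b := by
  simp [rectCells]

lemma ha_iff {a b : ℕ} {T : ℕ × ℕ → ℕ} {r s v : ℕ} (hr : r < a) (hs : s < b) :
    HA a b T r s v ↔ (s + 1 < b ∧ T (r, s + 1) = v) ∨ (∃ t, t + 1 = s ∧ T (r, t) = v) ∨
      (r + 1 < a ∧ T (r + 1, s) = v) ∨ (∃ t, t + 1 = r ∧ T (t, s) = v) := by
  constructor
  · rintro ⟨⟨x, y⟩, hd, h, hv⟩
    rw [mem_rect] at hd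
    simp only [incAdj] at h
    rcases h with ⟨rfl, rfl | h⟩ | ⟨rfl, rfl | h⟩
    · exact Or.inl ⟨hd.2, hv⟩
    · exact Or.inr (Or.inl ⟨y, h, hv⟩)
    · exact Or.inr (Or.inr (Or.inl ⟨hd.1, hv⟩))
    · exact Or.inr (Or.inr (Or.inr ⟨x, h, hv⟩))
  · rintro (⟨h, hv⟩ | ⟨t, rfl, hv⟩ | ⟨h, hv⟩ | ⟨t, rfl, hv⟩)
    · exact ⟨(r, s + 1), mem_rect.2 ⟨hr, h⟩, by simp [incAdj], hv⟩
    · exact ⟨(r, t), mem_rect.2 ⟨hr, by omega⟩, by simp [incAdj], hv⟩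
    · exact ⟨(r + 1, s), mem_rect.2 ⟨h, hs⟩, by simp [incAdj], hv⟩
    · exact ⟨(t, s), mem_rect.2 ⟨by omega, hs⟩, by simp [incAdj], hv⟩

lemma kbk_eq {a b : ℕ} {T : ℕ × ℕ → ℕ} (i : ℕ) {r s : ℕ} (hr : r < a) (hs : s < b) :
    kbkMap (rectCells a b) i T (r, s) =
      if T (r, s) = i ∧ ¬ HA a b T r s (i + 1) then i + 1
      else if T (r, s) = i + 1 ∧ ¬ HA a b T r s i then i else T (r, s) := by
  have : (r, s) ∈ rectCells a b := mem_rect.2 ⟨hr, hs⟩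
  simp only [kbkMap, this, true_and, HA]
  congr

/-- In a given row the values `v` and `v+1` are next to each other. -/
lemma row_mono {a b : ℕ} {T : ℕ × ℕ → ℕ} (h : Inc a b T) {r s : ℕ} (hr : r < a) (k : ℕ) :
    s + k < b → T (r, s) + k ≤ T (r, s + k) := by
  induction k with
  | zero => simp
  | succ k ih =>
    intro hk
    have := ih (by omega)
    have := h.1 r (s + k) hr (by omega)
    rw [← add_assoc s k 1]; omega

lemma row_inj {a b : ℕ} {T : ℕ × ℕ → ℕ} (h : Inc a b T) {r s t : ℕ} (hr : r < a)
    (hs : s < b) (ht : t < b) (e : T (r, s) = T (r, t)) : s = t := by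
  rcases lt_trichotomy s t with h1 | h1 | h1
  · obtain ⟨k, rfl⟩ := Nat.exists_eq_add_of_lt h1
    have := row_mono h hr (s := s) (k + 1) (by omega)
    rw [← add_assoc s k 1] at this; omega
  · exact h1
  · obtain ⟨k, rfl⟩ := Nat.exists_eq_add_of_lt h1
    have := row_mono h hr (s := t) (k + 1) (by omega)
    rw [← add_assoc t k 1] at this; omega

lemma row_succ {a b : ℕ} {T : ℕ × ℕ → ℕ} (h : Inc a b T) {r s t : ℕ} (hr : r < a)
    (hs : s < b) (ht : t < b) (e : T (r, t) = T (r, s) + 1) : t = s + 1 := by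
  rcases lt_trichotomy s t with h1 | h1 | h1
  · obtain ⟨k, rfl⟩ := Nat.exists_eq_add_of_lt h1
    have := row_mono h hr (s := s) (k + 1) (by omega)
    rw [← add_assoc s k 1] at this; omega
  · subst h1; omega
  · obtain ⟨k, rfl⟩ := Nat.exists_eq_add_of_lt h1
    have := row_mono h hr (s := t) (k + 1) (by omega)
    rw [← add_assoc t k 1] at this; omega

lemma kbk_lt {a b : ℕ} {T : ℕ × ℕ → ℕ} (i : ℕ) {r s r' s' : ℕ} (hr : r < a) (hs : s < b)
    (hr' : r' < a) (hs' : s' < b) (h : T (r, s) < T (r', s'))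
    (h1 : incAdj (r, s) (r', s')) (h2 : incAdj (r', s') (r, s)) :
    kbkMap (rectCells a b) i T (r, s) < kbkMap (rectCells a b) i T (r', s') := by
  have A : T (r', s') = i + 1 → HA a b T r s (i + 1) := fun e =>
    ⟨_, mem_rect.2 ⟨hr', hs'⟩, h1, e⟩
  have B : T (r, s) = i → HA a b T r' s' i := fun e =>
    ⟨_, mem_rect.2 ⟨hr, hs⟩, h2, e⟩
  rw [kbk_eq i hr hs, kbk_eq i hr' hs']
  grind

lemma kbk_inc {a b : ℕ} {T : ℕ × ℕ → ℕ} (h : Inc a b T) (i : ℕ) :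
    Inc a b (kbkMap (rectCells a b) i T) := by
  refine ⟨fun r s hr hs => ?_, fun r s hr hs => ?_⟩
  · exact kbk_lt i hr (by omega) hr hs (h.1 r s hr hs) (by simp [incAdj]) (by simp [incAdj])
  · exact kbk_lt i (by omega) hs hr hs (h.2 r s hr hs) (by simp [incAdj]) (by simp [incAdj])

lemma kbk_bd {a b q : ℕ} {T : ℕ × ℕ → ℕ} (h : Bd a b q T) (i : ℕ) (h1 : 1 ≤ i)
    (h2 : i + 1 ≤ q) : Bd a b q (kbkMap (rectCells a b) i T) := by
  intro r s hr hs
  have := h r s hr hs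
  rw [kbk_eq i hr hs]
  grind

/-- entries other than `i, i+1` are unaffected. -/
lemma kbk_other {μ : Finset (ℕ × ℕ)} {T : ℕ × ℕ → ℕ} {i v : ℕ} (c : ℕ × ℕ)
    (h1 : v ≠ i) (h2 : v ≠ i + 1) : kbkMap μ i T c = v ↔ T c = v := by
  unfold kbkMap
  grind

lemma kbk_def (μ : Finset (ℕ × ℕ)) (i : ℕ) (T : ℕ × ℕ → ℕ) (c : ℕ × ℕ) :
    kbkMap μ i T c =
      if c ∈ μ ∧ T c = i ∧ ¬ ∃ d ∈ μ, incAdj c d ∧ T d = i + 1 then i + 1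
      else if c ∈ μ ∧ T c = i + 1 ∧ ¬ ∃ d ∈ μ, incAdj c d ∧ T d = i then i
      else T c := rfl

lemma kbk_commute (μ : Finset (ℕ × ℕ)) (T : ℕ × ℕ → ℕ) {i j : ℕ} (h : i + 2 ≤ j) :
    kbkMap μ i (kbkMap μ j T) = kbkMap μ j (kbkMap μ i T) := by
  have e1 : ∀ d, kbkMap μ j T d = i ↔ T d = i := fun d => kbk_other d (by omega) (by omega)
  have e2 : ∀ d, kbkMap μ j T d = i + 1 ↔ T d = i + 1 :=
    fun d => kbk_other d (by omega) (by omega)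
  have e3 : ∀ d, kbkMap μ i T d = j ↔ T d = j := fun d => kbk_other d (by omega) (by omega)
  have e4 : ∀ d, kbkMap μ i T d = j + 1 ↔ T d = j + 1 :=
    fun d => kbk_other d (by omega) (by omega)
  funext c
  have A : T c ≠ j → T c ≠ j + 1 → kbkMap μ j T c = T c := fun x y =>
    (kbk_other c x y).2 rfl
  have B : T c ≠ i → T c ≠ i + 1 → kbkMap μ i T c = T c := fun x y =>
    (kbk_other c x y).2 rfl
  have L := kbk_def μ i (kbkMap μ j T) c
  have R := kbk_def μ j (kbkMap μ i T) c
  simp only [e1, e2] at L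
  simp only [e3, e4] at R
  have L' := kbk_def μ i T c
  have R' := kbk_def μ j T c
  rw [L, R]
  by_cases hc : T c = i ∨ T c = i + 1
  · have n1 : T c ≠ j := by omega
    have n2 : T c ≠ j + 1 := by omega
    rw [A n1 n2, L']
    simp [n1, n2]
  · push Not at hc
    rw [B hc.1 hc.2, R']
    simp [hc.1, hc.2]

def Des (a b : ℕ) (T : ℕ × ℕ → ℕ) (i : ℕ) : Prop :=
  ∃ r s r' s', r < a ∧ s < b ∧ r' < a ∧ s' < b ∧ T (r, s) = i ∧ T (r', s') = i + 1 ∧ r < r'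

lemma des_iff {a b : ℕ} {T : ℕ × ℕ → ℕ} {i : ℕ} : DescentAt a b T i ↔ Des a b T i := by
  constructor
  · rintro ⟨⟨r, s⟩, hc, ⟨r', s'⟩, hd, h1, h2, h3⟩
    rw [mem_rect] at hc hd
    exact ⟨r, s, r', s', hc.1, hc.2, hd.1, hd.2, h1, h2, h3⟩
  · rintro ⟨r, s, r', s', h1, h2, h3, h4, h5, h6, h7⟩
    exact ⟨(r, s), mem_rect.2 ⟨h1, h2⟩, (r', s'), mem_rect.2 ⟨h3, h4⟩, h5, h6, h7⟩

section vals
variable {a b : ℕ} {T : ℕ × ℕ → ℕ} {i r s : ℕ}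

lemma k_lo_stay (hr : r < a) (hs : s < b) (h : T (r, s) = i) (hh : HA a b T r s (i + 1)) :
    kbkMap (rectCells a b) i T (r, s) = i := by rw [kbk_eq i hr hs]; grind
lemma k_lo_up (hr : r < a) (hs : s < b) (h : T (r, s) = i) (hh : ¬ HA a b T r s (i + 1)) :
    kbkMap (rectCells a b) i T (r, s) = i + 1 := by rw [kbk_eq i hr hs]; grind
lemma k_hi_stay (hr : r < a) (hs : s < b) (h : T (r, s) = i + 1) (hh : HA a b T r s i) :
    kbkMap (rectCells a b) i T (r, s) = i + 1 := by rw [kbk_eq i hr hs]; grind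
lemma k_hi_down (hr : r < a) (hs : s < b) (h : T (r, s) = i + 1) (hh : ¬ HA a b T r s i) :
    kbkMap (rectCells a b) i T (r, s) = i := by rw [kbk_eq i hr hs]; grind
lemma k_inv_hi (hr : r < a) (hs : s < b) (h : kbkMap (rectCells a b) i T (r, s) = i + 1) :
    (T (r, s) = i ∧ ¬ HA a b T r s (i + 1)) ∨ (T (r, s) = i + 1 ∧ HA a b T r s i) := by
  rw [kbk_eq i hr hs] at h; grind
lemma k_inv_lo (hr : r < a) (hs : s < b) (h : kbkMap (rectCells a b) i T (r, s) = i) :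
    (T (r, s) = i ∧ HA a b T r s (i + 1)) ∨ (T (r, s) = i + 1 ∧ ¬ HA a b T r s i) := by
  rw [kbk_eq i hr hs] at h; grind

/-- neighbours with smaller values are left or above -/
lemma ha_lo (hI : Inc a b T) (hr : r < a) (hs : s < b) {v : ℕ} (hv : v < T (r, s)) :
    HA a b T r s v ↔ (∃ t, t + 1 = s ∧ T (r, t) = v) ∨ (∃ t, t + 1 = r ∧ T (t, s) = v) := by
  rw [ha_iff hr hs]
  have h1 := hI.1 r s hr
  have h2 := fun h => hI.2 r s h hs
  constructor
  · rintro (⟨h, e⟩ | h | ⟨h, e⟩ | h)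
    · have := h1 h; omega
    · exact Or.inl h
    · have := h2 h; omega
    · exact Or.inr h
  · rintro (h | h)
    · exact Or.inr (Or.inl h)
    · exact Or.inr (Or.inr (Or.inr h))

/-- neighbours with larger values are right or below -/
lemma ha_hi (hI : Inc a b T) (hr : r < a) (hs : s < b) {v : ℕ} (hv : T (r, s) < v) :
    HA a b T r s v ↔ (s + 1 < b ∧ T (r, s + 1) = v) ∨ (r + 1 < a ∧ T (r + 1, s) = v) := by
  rw [ha_iff hr hs]
  constructor
  · rintro (h | ⟨t, rfl, e⟩ | h | ⟨t, rfl, e⟩)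
    · exact Or.inl h
    · have := hI.1 r t hr hs; omega
    · exact Or.inr h
    · have := hI.2 t s hr hs; omega
  · rintro (h | h)
    · exact Or.inl h
    · exact Or.inr (Or.inr (Or.inl h))
end vals

/-- Local lemma A. -/
lemma localA {a b : ℕ} {T : ℕ × ℕ → ℕ} (hI : Inc a b T) (j : ℕ) (h : Des a b T (j + 1)) :
    Des a b (kbkMap (rectCells a b) (j + 1) (kbkMap (rectCells a b) j T)) j := by
  obtain ⟨r, s, r', s', hr, hs, hr', hs', hc, hd, hlt⟩ := h
  set U := kbkMap (rectCells a b) j T with hU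
  set V := kbkMap (rectCells a b) (j + 1) U with hV
  have hIU : Inc a b U := kbk_inc hI j
  have VU : ∀ c, V c = j ↔ U c = j := fun c => kbk_other c (by omega) (by omega)
  have UT : ∀ c, U c = j + 2 ↔ T c = j + 2 := fun c => kbk_other c (by omega) (by omega)
  -- a final `j` in row at most `r`
  have one : ∃ x y, x ≤ r ∧ y < b ∧ V (x, y) = j := by
    by_cases hh : HA a b T r s j
    · have hh' := hh
      rw [ha_lo hI hr hs (by omega)] at hh'
      rcases hh' with ⟨t, rfl, e⟩ | ⟨t, rfl, e⟩
      · refine ⟨r, t, le_rfl, by omega, (VU _).2 (k_lo_stay hr (by omega) e ?_)⟩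
        rw [ha_hi hI hr (by omega) (by omega)]
        exact Or.inl ⟨hs, hc⟩
      · refine ⟨t, s, by omega, by omega, (VU _).2 (k_lo_stay (by omega) (by omega) e ?_)⟩
        rw [ha_hi hI (by omega) (by omega) (by omega)]
        exact Or.inr ⟨hr, hc⟩
    · exact ⟨r, s, le_rfl, hs, (VU _).2 (k_hi_down hr hs hc hh)⟩
  obtain ⟨x, y, hx, hy, hxy⟩ := one
  have fin : ∀ p t, r < p → p < a → t < b → V (p, t) = j + 1 →
      Des a b V j := fun p t h1 h2 h3 h4 =>
    ⟨x, y, p, t, by omega, hy, h2, h3, hxy, h4, by omega⟩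
  have hdU : U (r', s') = j + 1 + 1 := (UT _).2 hd
  by_cases hh : HA a b U r' s' (j + 1)
  swap
  · exact fin r' s' hlt hr' hs' (k_hi_down hr' hs' hdU hh)
  rw [ha_lo hIU hr' hs' (by omega)] at hh
  rcases hh with ⟨t, rfl, e⟩ | ⟨t, rfl, e⟩
  · refine fin r' t hlt hr' (by omega) (k_lo_stay hr' (by omega) e ?_)
    rw [ha_hi hIU hr' (by omega) (by omega)]
    exact Or.inl ⟨hs', hdU⟩
  have ht : t < a := by omega
  have eV : V (t, s') = j + 1 := by
    refine k_lo_stay ht hs' e ?_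
    rw [ha_hi hIU ht hs' (by omega)]
    exact Or.inr ⟨hr', hdU⟩
  by_cases hrt : r < t
  · exact fin t s' hrt ht hs' eV
  obtain rfl : r = t := by omega
  have hss : s' = s ∧ HA a b T r s j := by
    rcases k_inv_hi ht hs' e with ⟨e1, e2⟩ | ⟨e1, e2⟩
    · exfalso
      have := row_succ hI hr hs' hs (by omega)
      subst this
      apply e2
      rw [ha_hi hI hr hs' (by omega)]
      exact Or.inl ⟨hs, hc⟩
    · have := row_inj hI hr hs' hs (by omega)
      subst this
      exact ⟨rfl, e2⟩
  obtain ⟨rfl, hh⟩ := hss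
  rw [ha_lo hI hr hs (by omega)] at hh
  rcases hh with ⟨t, rfl, e3⟩ | ⟨t, rfl, e3⟩
  · -- corner configuration
    have m1 := hI.2 r t hr' (by omega)
    have m2 := hI.1 (r + 1) t hr' (by omega)
    have m : T (r + 1, t) = j + 1 := by omega
    have mU : U (r + 1, t) = j + 1 := by
      refine k_hi_stay hr' (by omega) m ?_
      rw [ha_lo hI hr' (by omega) (by omega)]
      exact Or.inr ⟨r, rfl, e3⟩
    refine fin (r + 1) t (by omega) hr' (by omega) (k_lo_stay hr' (by omega) mU ?_)
    rw [ha_hi hIU hr' (by omega) (by omega)]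
    exact Or.inl ⟨hs, hdU⟩
  · refine ⟨t, s', t + 1, s', by omega, hs, hr, hs, ?_, eV, by omega⟩
    refine (VU _).2 (k_lo_stay (by omega) hs e3 ?_)
    rw [ha_hi hI (by omega) hs (by omega)]
    exact Or.inr ⟨hr, hc⟩

/-- Local lemma B, the dual of A. -/
lemma localB {a b : ℕ} {T : ℕ × ℕ → ℕ} (hI : Inc a b T) (j : ℕ) (h : Des a b T j) :
    Des a b (kbkMap (rectCells a b) j (kbkMap (rectCells a b) (j + 1) T)) (j + 1) := by
  obtain ⟨r, s, r', s', hr, hs, hr', hs', hc, hd, hlt⟩ := h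
  set U := kbkMap (rectCells a b) (j + 1) T with hU
  set V := kbkMap (rectCells a b) j U with hV
  have hIU : Inc a b U := kbk_inc hI (j + 1)
  have VU : ∀ c, V c = j + 2 ↔ U c = j + 2 := fun c => kbk_other c (by omega) (by omega)
  have UT : ∀ c, U c = j ↔ T c = j := fun c => kbk_other c (by omega) (by omega)
  -- a final `j + 2` in row at least `r'`
  have one : ∃ x y, r' ≤ x ∧ x < a ∧ y < b ∧ V (x, y) = j + 2 := by
    by_cases hh : HA a b T r' s' (j + 1 + 1)
    · have hh' := hh
      rw [ha_hi hI hr' hs' (by omega)] at hh'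
      rcases hh' with ⟨ht, e⟩ | ⟨ht, e⟩
      · refine ⟨r', s' + 1, le_rfl, hr', ht, (VU _).2 (k_hi_stay hr' ht e ?_)⟩
        rw [ha_lo hI hr' ht (by omega)]
        exact Or.inl ⟨s', rfl, hd⟩
      · refine ⟨r' + 1, s', by omega, ht, hs', (VU _).2 (k_hi_stay ht hs' e ?_)⟩
        rw [ha_lo hI ht hs' (by omega)]
        exact Or.inr ⟨r', rfl, hd⟩
    · exact ⟨r', s', le_rfl, hr', hs', (VU _).2 (k_lo_up hr' hs' hd hh)⟩
  obtain ⟨x, y, hx, hxa, hy, hxy⟩ := one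
  have fin : ∀ p t, p < r' → t < b → V (p, t) = j + 1 →
      Des a b V (j + 1) := fun p t h1 h3 h4 =>
    ⟨p, t, x, y, by omega, h3, hxa, hy, h4, hxy, by omega⟩
  have hcU : U (r, s) = j := (UT _).2 hc
  by_cases hh : HA a b U r s (j + 1)
  swap
  · exact fin r s hlt hs (k_lo_up hr hs hcU hh)
  rw [ha_hi hIU hr hs (by omega)] at hh
  rcases hh with ⟨ht, e⟩ | ⟨ht, e⟩
  · refine fin r (s + 1) hlt ht (k_hi_stay hr ht e ?_)
    rw [ha_lo hIU hr ht (by omega)]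
    exact Or.inl ⟨s, rfl, hcU⟩
  have eV : V (r + 1, s) = j + 1 := by
    refine k_hi_stay ht hs e ?_
    rw [ha_lo hIU ht hs (by omega)]
    exact Or.inr ⟨r, rfl, hcU⟩
  by_cases hrt : r + 1 < r'
  · exact fin (r + 1) s hrt hs eV
  obtain rfl : r' = r + 1 := by omega
  have hss : s = s' ∧ HA a b T (r + 1) s' (j + 1 + 1) := by
    rcases k_inv_lo ht hs e with ⟨e1, e2⟩ | ⟨e1, e2⟩
    · have := row_inj hI ht hs hs' (by omega)
      subst this
      exact ⟨rfl, e2⟩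
    · exfalso
      have := row_succ hI ht hs' hs (by omega)
      subst this
      apply e2
      rw [ha_lo hI ht hs (by omega)]
      exact Or.inl ⟨s', rfl, hd⟩
  obtain ⟨rfl, hh⟩ := hss
  rw [ha_hi hI hr' hs (by omega)] at hh
  rcases hh with ⟨h3, e3⟩ | ⟨h3, e3⟩
  · have m1 := hI.1 r s hr h3
    have m2 := hI.2 r (s + 1) hr' h3
    have m : T (r, s + 1) = j + 1 := by omega
    have mU : U (r, s + 1) = j + 1 := by
      refine k_lo_stay hr h3 m ?_
      rw [ha_hi hI hr h3 (by omega)]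
      exact Or.inr ⟨ht, e3⟩
    refine fin r (s + 1) (by omega) h3 (k_hi_stay hr h3 mU ?_)
    rw [ha_lo hIU hr h3 (by omega)]
    exact Or.inl ⟨s, rfl, hcU⟩
  · refine ⟨r + 1, s, r + 1 + 1, s, hr', hs, h3, hs, eV, ?_, by omega⟩
    refine (VU _).2 (k_hi_stay h3 hs e3 ?_)
    rw [ha_lo hI h3 hs (by omega)]
    exact Or.inr ⟨r + 1, rfl, hd⟩

lemma first {a b q : ℕ} {T : ℕ × ℕ → ℕ} (hI : Inc a b T) (hB : Bd a b q T)
    (h : Des a b T 1) : Des a b (kbkMap (rectCells a b) 1 T) 1 := by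
  obtain ⟨r, s, r', s', hr, hs, hr', hs', hc, hd, hlt⟩ := h
  obtain ⟨t, rfl⟩ : ∃ t, r' = t + 1 := ⟨r' - 1, by omega⟩
  have h1 := hI.2 t s' hr' hs'
  have h2 := hB t s' (by omega) hs'
  have h3 : T (t, s') = 1 := by omega
  refine ⟨t, s', t + 1, s', by omega, hs', hr', hs', k_lo_stay (by omega) hs' h3 ?_,
    k_hi_stay hr' hs' hd ?_, by omega⟩
  · rw [ha_hi hI (by omega) hs' (by omega)]
    exact Or.inr ⟨hr', hd⟩
  · rw [ha_lo hI hr' hs' (by omega)]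
    exact Or.inr ⟨t, rfl, h3⟩

lemma last {a b m : ℕ} {T : ℕ × ℕ → ℕ} (hI : Inc a b T) (hB : Bd a b (m + 1) T)
    (h : Des a b T m) : Des a b (kbkMap (rectCells a b) m T) m := by
  obtain ⟨r, s, r', s', hr, hs, hr', hs', hc, hd, hlt⟩ := h
  have h0 : r + 1 < a := by omega
  have h1 := hI.2 r s h0 hs
  have h2 := hB (r + 1) s h0 hs
  have h3 : T (r + 1, s) = m + 1 := by omega
  refine ⟨r, s, r + 1, s, hr, hs, h0, hs, k_lo_stay hr hs hc ?_, k_hi_stay h0 hs h3 ?_, by omega⟩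
  · rw [ha_hi hI hr hs (by omega)]
    exact Or.inr ⟨h0, h3⟩
  · rw [ha_lo hI h0 hs (by omega)]
    exact Or.inr ⟨r, rfl, hc⟩

noncomputable def P (μ : Finset (ℕ × ℕ)) (n : ℕ) (T : ℕ × ℕ → ℕ) : ℕ × ℕ → ℕ :=
  (List.range n).foldl (fun S k => kbkMap μ (k + 1) S) T

lemma P_succ (μ : Finset (ℕ × ℕ)) (n : ℕ) (T : ℕ × ℕ → ℕ) :
    P μ (n + 1) T = kbkMap μ (n + 1) (P μ n T) := by
  simp [P, List.range_succ]

lemma P_inc {a b : ℕ} {T : ℕ × ℕ → ℕ} (h : Inc a b T) (n : ℕ) :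
    Inc a b (P (rectCells a b) n T) := by
  induction n with
  | zero => exact h
  | succ n ih => rw [P_succ]; exact kbk_inc ih _

lemma P_bd {a b q : ℕ} {T : ℕ × ℕ → ℕ} (h : Bd a b q T) (n : ℕ) (hn : n + 1 ≤ q) :
    Bd a b q (P (rectCells a b) n T) := by
  induction n with
  | zero => exact h
  | succ n ih => rw [P_succ]; exact kbk_bd (ih (by omega)) _ (by omega) hn

lemma P_high {μ : Finset (ℕ × ℕ)} {T : ℕ × ℕ → ℕ} (n v : ℕ) (hv : n + 2 ≤ v) (c : ℕ × ℕ) :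
    P μ n T c = v ↔ T c = v := by
  induction n with
  | zero => rfl
  | succ n ih => rw [P_succ, kbk_other c (by omega) (by omega), ih (by omega)]

lemma P_low {μ : Finset (ℕ × ℕ)} {T : ℕ × ℕ → ℕ} (n k v : ℕ) (hv : v ≤ n) (c : ℕ × ℕ) :
    P μ (n + k) T c = v ↔ P μ n T c = v := by
  induction k with
  | zero => rfl
  | succ k ih => rw [← add_assoc, P_succ, kbk_other c (by omega) (by omega), ih]

lemma P_comm (μ : Finset (ℕ × ℕ)) (T : ℕ × ℕ → ℕ) (n j : ℕ) (h : n + 2 ≤ j) :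
    P μ n (kbkMap μ j T) = kbkMap μ j (P μ n T) := by
  induction n with
  | zero => rfl
  | succ n ih => rw [P_succ, P_succ, ih (by omega), kbk_commute _ _ (by omega)]

lemma twice {a b q : ℕ} {T : ℕ × ℕ → ℕ} (hI : Inc a b T) (hB : Bd a b q T)
    (h : Des a b T 1) (n : ℕ) :
    Des a b (P (rectCells a b) n (P (rectCells a b) (n + 1) T)) (n + 1) := by
  induction n with
  | zero => exact first hI hB h
  | succ n ih =>
    rw [P_succ _ n, P_succ _ (n + 1), P_comm _ _ _ _ (by omega)]
    exact localB (P_inc (P_inc hI _) _) _ ih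

end DS

/-- Lemma 2.6: if `i` is a descent of `T ∈ Inc^q(a×b)`, then `i - 1` (mod `q`,
i.e. `q` when `i = 1`) is a descent of `∂(T)`. -/
theorem descent_shifts (a b q : ℕ) (ha : 0 < a) (hb : 0 < b) (hq : 0 < q)
    (T : ℕ × ℕ → ℕ) (hT : IsIncTab (rectCells a b) q T)
    (i : ℕ) (hi1 : 1 ≤ i) (hiq : i ≤ q) (hdes : IsDescent a b q T i) :
    IsDescent a b q (kPromo (rectCells a b) q T) (if i = 1 then q else i - 1) := by
  have hI : DS.Inc a b T := by
    refine ⟨fun r s hr hs => ?_, fun r s hr hs => ?_⟩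
    · exact hT.2.1 _ (DS.mem_rect.2 ⟨hr, by omega⟩) _ (DS.mem_rect.2 ⟨hr, hs⟩) rfl (by simp)
    · exact hT.2.2 _ (DS.mem_rect.2 ⟨by omega, hs⟩) _ (DS.mem_rect.2 ⟨hr, hs⟩) rfl (by simp)
  have hB : DS.Bd a b q T := fun r s hr hs => hT.1 _ (DS.mem_rect.2 ⟨hr, hs⟩)
  have hP : ∀ S, kPromo (rectCells a b) q S = DS.P (rectCells a b) (q - 1) S := fun _ => rfl
  unfold IsDescent at hdes ⊢
  simp only [hP, DS.des_iff] at hdes ⊢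
  by_cases hi : i = 1
  · subst hi
    rw [if_pos rfl, if_pos rfl]
    by_cases hq1 : q = 1
    · subst hq1
      exact hdes
    · rw [if_neg (by omega)] at hdes
      obtain ⟨n, rfl⟩ : ∃ n, q = n + 2 := ⟨q - 2, by omega⟩
      have key := DS.twice hI hB hdes n
      have e : n + 2 - 1 = n + 1 := by omega
      rw [e]
      rw [DS.P_succ _ n (DS.P _ _ _)]
      refine DS.last (DS.P_inc (DS.P_inc hI _) _) ?_ key
      exact DS.P_bd (DS.P_bd hB _ (by omega)) _ (by omega)
  · rw [if_neg hi, if_neg (by omega)]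
    by_cases hiq' : i = q
    · subst hiq'
      rw [if_pos rfl] at hdes
      exact hdes
    · rw [if_neg hiq'] at hdes
      obtain ⟨j, rfl⟩ : ∃ j, i = j + 2 := ⟨i - 2, by omega⟩
      obtain ⟨k, rfl⟩ : ∃ k, q = j + 2 + k + 1 := ⟨q - (j + 3), by omega⟩
      have h1 : DS.Des a b (DS.P (rectCells a b) j T) (j + 1 + 1) := by
        obtain ⟨r, s, r', s', hr, hs, hr', hs', hc, hd, hlt⟩ := hdes
        exact ⟨r, s, r', s', hr, hs, hr', hs', (DS.P_high _ _ (by omega) _).2 hc,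
          (DS.P_high _ _ (by omega) _).2 hd, hlt⟩
      have h2 := DS.localA (DS.P_inc hI j) (j + 1) h1
      rw [← DS.P_succ, ← DS.P_succ] at h2
      have e1 : j + 2 - 1 = j + 1 := by omega
      have e2 : j + 2 + k + 1 - 1 = (j + 1 + 1) + k := by omega
      rw [e1, e2]
      obtain ⟨r, s, r', s', hr, hs, hr', hs', hc, hd, hlt⟩ := h2
      exact ⟨r, s, r', s', hr, hs, hr', hs', (DS.P_low _ _ _ (by omega) _).2 hc,
        (DS.P_low _ _ _ (by omega) _).2 hd, hlt⟩
end

section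
/- For T ∈ Inc^q(a×b) and i ∈ {1,…,q}: i is a descent of T if and only if i−1 (if i ≥ 2), respectively q (if i = 1), is a descent of ∂(T). -/
open scoped Classical

section helpers

variable {a b q : ℕ} {T : ℕ × ℕ → ℕ}

theorem mem_rect (p : ℕ × ℕ) : p ∈ rectCells a b ↔ p.1 < a ∧ p.2 < b := by
  simp [rectCells]

theorem incAdj_symm {c d : ℕ × ℕ} (h : incAdj c d) : incAdj d c := by
  unfold incAdj at *; omega

theorem kbk_iff_far (μ : Finset (ℕ × ℕ)) (T : ℕ × ℕ → ℕ) (c : ℕ × ℕ) {i j : ℕ}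
    (h1 : j ≠ i) (h2 : j ≠ i + 1) :
    kbkMap μ i T c = j ↔ T c = j := by
  unfold kbkMap
  split_ifs <;> omega

theorem kbk_other (μ : Finset (ℕ × ℕ)) {c : ℕ × ℕ} {i : ℕ}
    (h1 : T c ≠ i) (h2 : T c ≠ i + 1) : kbkMap μ i T c = T c := by
  unfold kbkMap
  split_ifs <;> omega

theorem kbk_not_mem (μ : Finset (ℕ × ℕ)) {c : ℕ × ℕ} {i : ℕ}
    (h : c ∉ μ) : kbkMap μ i T c = T c := by
  simp [kbkMap, h]

theorem kbk_adj (μ : Finset (ℕ × ℕ)) {c d : ℕ × ℕ} {i : ℕ} (hc : c ∈ μ) (hd : d ∈ μ)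
    (h : incAdj c d) (h1 : T c = i) (h2 : T d = i + 1) :
    kbkMap μ i T c = i ∧ kbkMap μ i T d = i + 1 := by
  have h' := incAdj_symm h
  constructor
  · unfold kbkMap
    rw [if_neg (fun hh => hh.2.2 ⟨d, hd, h, h2⟩), if_neg (by omega), h1]
  · unfold kbkMap
    rw [if_neg (by omega), if_neg (fun hh => hh.2.2 ⟨c, hc, h', h1⟩), h2]

theorem kbk_lo (μ : Finset (ℕ × ℕ)) {c : ℕ × ℕ} {i : ℕ} (hc : c ∈ μ) (h1 : T c = i) :
    (kbkMap μ i T c = i + 1 ∧ ∀ d ∈ μ, incAdj c d → T d ≠ i + 1) ∨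
    (kbkMap μ i T c = i ∧ ∃ d ∈ μ, incAdj c d ∧ T d = i + 1 ∧ kbkMap μ i T d = i + 1) := by
  by_cases h : ∃ d ∈ μ, incAdj c d ∧ T d = i + 1
  · right
    obtain ⟨d, hd, had, h2⟩ := h
    have := kbk_adj μ hc hd had h1 h2
    exact ⟨this.1, d, hd, had, h2, this.2⟩
  · left
    refine ⟨?_, fun d hd had h2 => h ⟨d, hd, had, h2⟩⟩
    unfold kbkMap
    rw [if_pos ⟨hc, h1, h⟩]

theorem kbk_hi (μ : Finset (ℕ × ℕ)) {c : ℕ × ℕ} {i : ℕ} (hc : c ∈ μ) (h1 : T c = i + 1) :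
    (kbkMap μ i T c = i ∧ ∀ d ∈ μ, incAdj c d → T d ≠ i) ∨
    (kbkMap μ i T c = i + 1 ∧ ∃ d ∈ μ, incAdj c d ∧ T d = i ∧ kbkMap μ i T d = i) := by
  by_cases h : ∃ d ∈ μ, incAdj c d ∧ T d = i
  · right
    obtain ⟨d, hd, had, h2⟩ := h
    have := kbk_adj μ hd hc (incAdj_symm had) h2 h1
    exact ⟨this.2, d, hd, had, h2, this.1⟩
  · left
    refine ⟨?_, fun d hd had h2 => h ⟨d, hd, had, h2⟩⟩
    unfold kbkMap
    rw [if_neg (by omega), if_pos ⟨hc, h1, h⟩]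

theorem inc_adj_ne (hT : IsIncTab (rectCells a b) q T) {c d : ℕ × ℕ}
    (hc : c ∈ rectCells a b) (hd : d ∈ rectCells a b) (h : incAdj c d) : T c ≠ T d := by
  obtain ⟨_, hr, hk⟩ := hT
  have r1 := hr c hc d hd
  have r2 := hr d hd c hc
  have r3 := hk c hc d hd
  have r4 := hk d hd c hc
  unfold incAdj at h
  omega

theorem inc_adj_lt (hT : IsIncTab (rectCells a b) q T) {c d : ℕ × ℕ}
    (hc : c ∈ rectCells a b) (hd : d ∈ rectCells a b) (h : incAdj c d) (hlt : T c < T d) :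
    (d.1 = c.1 ∧ d.2 = c.2 + 1) ∨ (d.1 = c.1 + 1 ∧ d.2 = c.2) := by
  obtain ⟨_, hr, hk⟩ := hT
  have r2 := hr d hd c hc
  have r4 := hk d hd c hc
  unfold incAdj at h
  omega

/-- Consecutive entries in a row are adjacent. -/
theorem inc_row_consec (hT : IsIncTab (rectCells a b) q T) {c d : ℕ × ℕ}
    (hc : c ∈ rectCells a b) (hd : d ∈ rectCells a b) (h : c.1 = d.1) (he : T d = T c + 1) :
    d.2 = c.2 + 1 := by
  obtain ⟨_, hr, hk⟩ := hT
  rcases lt_trichotomy c.2 d.2 with h1 | h1 | h1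
  · by_contra hne
    have hm : (c.1, c.2 + 1) ∈ rectCells a b := by
      rw [mem_rect] at *; simp only; omega
    have := hr c hc _ hm rfl (by simp)
    have := hr _ hm d hd h (by simp only; omega)
    omega
  · have : c = d := Prod.ext h h1
    subst this; omega
  · have := hr d hd c hc h.symm h1
    omega

theorem inc_col_consec (hT : IsIncTab (rectCells a b) q T) {c d : ℕ × ℕ}
    (hc : c ∈ rectCells a b) (hd : d ∈ rectCells a b) (h : c.2 = d.2) (he : T d = T c + 1) :
    d.1 = c.1 + 1 := by
  obtain ⟨_, hr, hk⟩ := hT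
  rcases lt_trichotomy c.1 d.1 with h1 | h1 | h1
  · by_contra hne
    have hm : (c.1 + 1, c.2) ∈ rectCells a b := by
      rw [mem_rect] at *; simp only; omega
    have := hk c hc _ hm rfl (by simp)
    have := hk _ hm d hd h (by simp only; omega)
    omega
  · have : c = d := Prod.ext h1 h
    subst this; omega
  · have := hk d hd c hc h.symm h1
    omega

theorem inc_row_inj (hT : IsIncTab (rectCells a b) q T) {c d : ℕ × ℕ}
    (hc : c ∈ rectCells a b) (hd : d ∈ rectCells a b) (h : c.1 = d.1) (he : T c = T d) :
    c = d := by
  obtain ⟨_, hr, hk⟩ := hT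
  rcases lt_trichotomy c.2 d.2 with h1 | h1 | h1
  · have := hr c hc d hd h h1; omega
  · exact Prod.ext h h1
  · have := hr d hd c hc h.symm h1; omega

theorem kbk_lt (hT : IsIncTab (rectCells a b) q T) {c d : ℕ × ℕ} (i : ℕ)
    (hc : c ∈ rectCells a b) (hd : d ∈ rectCells a b) (hlt : T c < T d)
    (hadj : T d = T c + 1 → incAdj c d) :
    kbkMap (rectCells a b) i T c < kbkMap (rectCells a b) i T d := by
  by_cases h1 : T c = i
  · by_cases h2 : T d = i + 1
    · have := kbk_adj _ hc hd (hadj (by omega)) h1 h2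
      omega
    · have := kbk_other (rectCells a b) (T := T) (c := d) (i := i) (by omega) h2
      have := kbk_lo _ hc h1
      omega
  · by_cases h2 : T c = i + 1
    · have := kbk_other (rectCells a b) (T := T) (c := d) (i := i) (by omega) (by omega)
      have := kbk_hi _ hc h2
      omega
    · have e1 := kbk_other (rectCells a b) h1 h2
      by_cases h3 : T d = i
      · have := kbk_lo _ hd h3
        omega
      · by_cases h4 : T d = i + 1
        · have := kbk_hi _ hd h4
          omega
        · have := kbk_other (rectCells a b) h3 h4
          omega

theorem kbk_inc (hT : IsIncTab (rectCells a b) q T) {i : ℕ} (hi : 1 ≤ i) (hiq : i + 1 ≤ q) :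
    IsIncTab (rectCells a b) q (kbkMap (rectCells a b) i T) := by
  refine ⟨fun c hc => ?_, fun c hc d hd h hlt => ?_, fun c hc d hd h hlt => ?_⟩
  · have := hT.1 c hc
    unfold kbkMap
    split_ifs <;> omega
  · refine kbk_lt hT i hc hd (hT.2.1 c hc d hd h hlt) fun he => ?_
    have := inc_row_consec hT hc hd h he
    unfold incAdj; omega
  · refine kbk_lt hT i hc hd (hT.2.2 c hc d hd h hlt) fun he => ?_
    have := inc_col_consec hT hc hd h he
    unfold incAdj; omega

theorem kbk_invol (hT : IsIncTab (rectCells a b) q T) (i : ℕ) :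
    kbkMap (rectCells a b) i (kbkMap (rectCells a b) i T) = T := by
  funext c
  by_cases hc : c ∈ rectCells a b
  swap
  · rw [kbk_not_mem _ hc, kbk_not_mem _ hc]
  by_cases h1 : T c = i
  · rcases kbk_lo _ hc h1 with ⟨h2, h3⟩ | ⟨h2, d, hd, had, h3, h4⟩
    · rcases kbk_hi _ hc h2 with h5 | ⟨_, d, hd, had, h5, _⟩
      · omega
      · exfalso
        have n1 := inc_adj_ne hT hc hd had
        have n2 := h3 d hd had
        rw [kbk_other _ (by omega) n2] at h5
        omega
    · have := kbk_adj _ hc hd had h2 h4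
      omega
  · by_cases h2 : T c = i + 1
    · rcases kbk_hi _ hc h2 with ⟨h2, h3⟩ | ⟨h2, d, hd, had, h3, h4⟩
      · rcases kbk_lo _ hc h2 with h5 | ⟨_, d, hd, had, h5, _⟩
        · omega
        · exfalso
          have n1 := inc_adj_ne hT hc hd had
          have n2 := h3 d hd had
          rw [kbk_other _ n2 (by omega)] at h5
          omega
      · have := kbk_adj _ hd hc (incAdj_symm had) h4 h2
        omega
    · have := kbk_other (rectCells a b) h1 h2
      rw [kbk_other _ (by omega) (by omega), this]

theorem kbk_comm (μ : Finset (ℕ × ℕ)) (T : ℕ × ℕ → ℕ) {i j : ℕ} (h : i + 1 < j) :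
    kbkMap μ i (kbkMap μ j T) = kbkMap μ j (kbkMap μ i T) := by
  have A := fun c => kbk_iff_far μ T c (i := j) (j := i) (by omega) (by omega)
  have B := fun c => kbk_iff_far μ T c (i := j) (j := i + 1) (by omega) (by omega)
  have C := fun c => kbk_iff_far μ T c (i := i) (j := j) (by omega) (by omega)
  have D := fun c => kbk_iff_far μ T c (i := i) (j := j + 1) (by omega) (by omega)
  funext c
  rw [kbkMap, kbkMap.eq_1 μ j (kbkMap μ i T)]
  simp only [A, B, C, D]
  by_cases h1 : T c = i ∨ T c = i + 1
  · rw [kbk_other μ (c := c) (i := j) (by omega) (by omega)]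
    rw [if_neg (c := c ∈ μ ∧ T c = j ∧ _) (by omega),
      if_neg (c := c ∈ μ ∧ T c = j + 1 ∧ _) (by omega)]
    rfl
  · rw [kbk_other μ (c := c) (i := i) (by omega) (by omega)]
    rw [if_neg (c := c ∈ μ ∧ T c = i ∧ _) (by omega),
      if_neg (c := c ∈ μ ∧ T c = i + 1 ∧ _) (by omega)]
    rfl

theorem desc_far (T : ℕ × ℕ → ℕ) {i j : ℕ} (h : i + 1 < j ∨ j + 1 < i) :
    DescentAt a b (kbkMap (rectCells a b) i T) j ↔ DescentAt a b T j := by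
  unfold DescentAt
  have A := fun c => kbk_iff_far (rectCells a b) T c (i := i) (j := j) (by omega) (by omega)
  have B := fun c => kbk_iff_far (rectCells a b) T c (i := i) (j := j + 1) (by omega) (by omega)
  simp only [A, B]

theorem local_fwd {S : ℕ × ℕ → ℕ} (hS : IsIncTab (rectCells a b) q S) {i : ℕ} (hi : 1 ≤ i)
    (hiq : i + 2 ≤ q) (h : DescentAt a b S (i + 1)) :
    DescentAt a b (kbkMap (rectCells a b) (i + 1) (kbkMap (rectCells a b) i S)) i := by
  obtain ⟨c, hc, d, hd, h1, h2, hlt⟩ := h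
  have hS' := kbk_inc hS (i := i) hi (by omega)
  have hinv := kbk_invol hS i
  have hd' : kbkMap (rectCells a b) i S d = i + 2 := by
    rw [kbk_iff_far _ _ _ (by omega) (by omega)]; exact h2
  -- persistence of entries i in the second step
  have keep : ∀ e, kbkMap (rectCells a b) i S e = i →
      kbkMap (rectCells a b) (i + 1) (kbkMap (rectCells a b) i S) e = i := by
    intro e he
    rw [kbk_iff_far _ _ _ (by omega) (by omega)]; exact he
  -- an entry i weakly above c
  have hx : ∃ x ∈ rectCells a b, kbkMap (rectCells a b) i S x = i ∧
      (x.1 < c.1 ∨ x = c ∨ (S x = i ∧ x.1 = c.1 ∧ c.2 = x.2 + 1 ∧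
        kbkMap (rectCells a b) i S c = i + 1)) := by
    rcases kbk_hi _ hc h1 with ⟨h3, _⟩ | ⟨h3, x, hx, had, h4, h5⟩
    · exact ⟨c, hc, h3, by tauto⟩
    · refine ⟨x, hx, h5, ?_⟩
      rcases inc_adj_lt hS hx hc (incAdj_symm had) (by omega) with h6 | h6
      · right; right; exact ⟨h4, h6.1.symm, h6.2, h3⟩
      · left; omega
  obtain ⟨x, hxm, hx1, hx2⟩ := hx
  have hxle : x.1 ≤ c.1 := by
    rcases hx2 with h | h | h
    · omega
    · rw [h]
    · omega
  rcases kbk_hi _ hd hd' with ⟨h3, _⟩ | ⟨_, e, he, had, h4, h5⟩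
  · exact ⟨x, hxm, d, hd, keep x hx1, h3, by omega⟩
  · rcases inc_adj_lt hS' he hd (incAdj_symm had) (by omega) with h6 | h6
    · exact ⟨x, hxm, e, he, keep x hx1, h5, by omega⟩
    · by_cases hxe : x.1 < e.1
      · exact ⟨x, hxm, e, he, keep x hx1, h5, hxe⟩
      · rcases hx2 with h7 | h7 | ⟨h7, h8, h9, h10⟩
        · omega
        · -- x = c : contradiction
          exfalso
          subst h7
          have hr : x.1 = e.1 := by omega
          have := inc_row_consec hS' hxm he hr (by omega)
          have := kbk_adj _ hxm he (by unfold incAdj; omega) hx1 h4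
          rw [hinv] at this
          omega
        · have hce : c = e := inc_row_inj hS' hc he (by omega) (by omega)
          subst hce
          have hm : (x.1 + 1, x.2) ∈ rectCells a b := by
            rw [mem_rect] at *; simp only; omega
          have g1 := hS.2.2 x hxm _ hm rfl (by simp)
          have g2 := hS.2.1 _ hm d hd (by simp only; omega) (by simp only; omega)
          have g3 : S (x.1 + 1, x.2) = i + 1 := by omega
          have g4 := kbk_adj _ hxm hm (by unfold incAdj; simp) h7 g3
          have g5 := kbk_adj (i := i + 1) _ hm hd (by unfold incAdj; simp only; omega) g4.2 hd'
          exact ⟨x, hxm, _, hm, keep x hx1, g5.1, by simp⟩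

theorem local_bwd {S : ℕ × ℕ → ℕ} (hS : IsIncTab (rectCells a b) q S) {i : ℕ} (hi : 1 ≤ i)
    (hiq : i + 2 ≤ q) (h : DescentAt a b S i) :
    DescentAt a b (kbkMap (rectCells a b) i (kbkMap (rectCells a b) (i + 1) S)) (i + 1) := by
  obtain ⟨d, hd, c, hc, h2, h1, hlt⟩ := h
  have hS' := kbk_inc hS (i := i + 1) (by omega) (by omega)
  have hinv := kbk_invol hS (i + 1)
  have hd' : kbkMap (rectCells a b) (i + 1) S d = i := by
    rw [kbk_iff_far _ _ _ (by omega) (by omega)]; exact h2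
  have keep : ∀ e, kbkMap (rectCells a b) (i + 1) S e = i + 1 + 1 →
      kbkMap (rectCells a b) i (kbkMap (rectCells a b) (i + 1) S) e = i + 1 + 1 := by
    intro e he
    rw [kbk_iff_far _ _ _ (by omega) (by omega)]; exact he
  have hx : ∃ x ∈ rectCells a b, kbkMap (rectCells a b) (i + 1) S x = i + 1 + 1 ∧
      (c.1 < x.1 ∨ x = c ∨ (S x = i + 1 + 1 ∧ x.1 = c.1 ∧ x.2 = c.2 + 1 ∧
        kbkMap (rectCells a b) (i + 1) S c = i + 1)) := by
    rcases kbk_lo _ hc h1 with ⟨h3, _⟩ | ⟨h3, x, hx, had, h4, h5⟩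
    · exact ⟨c, hc, h3, by tauto⟩
    · refine ⟨x, hx, h5, ?_⟩
      rcases inc_adj_lt hS hc hx had (by omega) with h6 | h6
      · right; right; exact ⟨h4, h6.1, h6.2, h3⟩
      · left; omega
  obtain ⟨x, hxm, hx1, hx2⟩ := hx
  have hxle : c.1 ≤ x.1 := by
    rcases hx2 with h | h | h
    · omega
    · rw [h]
    · omega
  rcases kbk_lo _ hd hd' with ⟨h3, _⟩ | ⟨_, e, he, had, h4, h5⟩
  · exact ⟨d, hd, x, hxm, h3, keep x hx1, by omega⟩
  · rcases inc_adj_lt hS' hd he had (by omega) with h6 | h6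
    · exact ⟨e, he, x, hxm, h5, keep x hx1, by omega⟩
    · by_cases hxe : e.1 < x.1
      · exact ⟨e, he, x, hxm, h5, keep x hx1, hxe⟩
      · rcases hx2 with h7 | h7 | ⟨h7, h8, h9, h10⟩
        · omega
        · exfalso
          subst h7
          have hr : e.1 = x.1 := by omega
          have := inc_row_consec hS' he hxm hr (by omega)
          have := kbk_adj _ he hxm (by unfold incAdj; omega) h4 hx1
          rw [hinv] at this
          omega
        · have hce : c = e := inc_row_inj hS' hc he (by omega) (by omega)
          subst hce
          have hm : (d.1, d.2 + 1) ∈ rectCells a b := by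
            rw [mem_rect] at *; simp only; omega
          have g1 := hS.2.1 d hd _ hm rfl (by simp)
          have g2 := hS.2.2 _ hm x hxm (by simp only; omega) (by simp only; omega)
          have g3 : S (d.1, d.2 + 1) = i + 1 := by omega
          have g4 := kbk_adj (i := i + 1) _ hm hxm (by unfold incAdj; simp only; omega) g3 h7
          have g5 := kbk_adj (i := i) _ hd hm (by unfold incAdj; simp) hd' g4.1
          exact ⟨_, hm, x, hxm, g5.2, keep x hx1, by simp only; omega⟩

theorem local_iff1 {S : ℕ × ℕ → ℕ} (hS : IsIncTab (rectCells a b) q S) {i : ℕ} (hi : 1 ≤ i)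
    (hiq : i + 2 ≤ q) : DescentAt a b S (i + 1) ↔
    DescentAt a b (kbkMap (rectCells a b) (i + 1) (kbkMap (rectCells a b) i S)) i := by
  refine ⟨local_fwd hS hi hiq, fun h => ?_⟩
  have h1 := kbk_inc hS hi (by omega)
  have := local_bwd (kbk_inc h1 (i := i + 1) (by omega) (by omega)) hi hiq h
  rwa [kbk_invol h1, kbk_invol hS] at this

theorem local_iff2 {S : ℕ × ℕ → ℕ} (hS : IsIncTab (rectCells a b) q S) {i : ℕ} (hi : 1 ≤ i)
    (hiq : i + 2 ≤ q) : DescentAt a b S i ↔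
    DescentAt a b (kbkMap (rectCells a b) i (kbkMap (rectCells a b) (i + 1) S)) (i + 1) := by
  refine ⟨local_bwd hS hi hiq, fun h => ?_⟩
  have h1 := kbk_inc hS (i := i + 1) (by omega) (by omega)
  have := local_fwd (kbk_inc h1 (i := i) (by omega) (by omega)) hi hiq h
  rwa [kbk_invol h1, kbk_invol hS] at this

/-- In the top-left corner, an entry `1` strictly above an entry `2` is adjacent to it. -/
theorem first_aux (hT : IsIncTab (rectCells a b) q T) (h : DescentAt a b T 1) :
    DescentAt a b (kbkMap (rectCells a b) 1 T) 1 := by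
  obtain ⟨c, hc, d, hd, h1, h2, hlt⟩ := h
  have hc1 : c.2 = 0 := by
    by_contra hne
    have hm : (c.1, 0) ∈ rectCells a b := by
      rw [mem_rect] at *; simp only; omega
    have := hT.2.1 _ hm c hc rfl (by simp only; omega)
    have := hT.1 _ hm
    omega
  have hd1 : d.2 = 0 := by
    by_contra hne
    have hm : (d.1, 0) ∈ rectCells a b := by
      rw [mem_rect] at *; simp only; omega
    have hm' : (c.1, 0) ∈ rectCells a b := by
      rw [mem_rect] at *; simp only; omega
    have := hT.2.1 _ hm d hd rfl (by simp only; omega)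
    have := hT.2.2 _ hm' _ hm rfl (by simp only; omega)
    have := hT.1 _ hm'
    omega
  have := inc_col_consec hT hc hd (by omega) (by omega)
  have := kbk_adj _ hc hd (by unfold incAdj; omega) h1 h2
  exact ⟨c, hc, d, hd, this.1, this.2, hlt⟩

theorem last_aux {n : ℕ} (hT : IsIncTab (rectCells a b) (n + 1) T) (h : DescentAt a b T n) :
    DescentAt a b (kbkMap (rectCells a b) n T) n := by
  obtain ⟨c, hc, d, hd, h1, h2, hlt⟩ := h
  have mc := (mem_rect c).1 hc
  have md := (mem_rect d).1 hd
  have hd1 : d.2 = b - 1 := by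
    by_contra hne
    have hm : (d.1, b - 1) ∈ rectCells a b := by
      rw [mem_rect] at *; simp only; omega
    have := hT.2.1 d hd _ hm rfl (by simp only; omega)
    have := hT.1 _ hm
    omega
  have hc1 : c.2 = b - 1 := by
    by_contra hne
    have hm : (c.1, b - 1) ∈ rectCells a b := by
      rw [mem_rect] at *; simp only; omega
    have := hT.2.1 c hc _ hm rfl (by simp only; omega)
    have := hT.2.2 _ hm d hd (by simp only; omega) (by simp only; omega)
    omega
  have := inc_col_consec hT hc hd (by omega) (by omega)
  have := kbk_adj _ hc hd (by unfold incAdj; omega) h1 h2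
  exact ⟨c, hc, d, hd, this.1, this.2, hlt⟩

/-- Partial promotion `kbk_k ∘ ⋯ ∘ kbk_1`. -/
noncomputable def partPromo (μ : Finset (ℕ × ℕ)) : ℕ → (ℕ × ℕ → ℕ) → (ℕ × ℕ → ℕ)
  | 0, T => T
  | k + 1, T => kbkMap μ (k + 1) (partPromo μ k T)

theorem kPromo_eq (μ : Finset (ℕ × ℕ)) (q : ℕ) (T : ℕ × ℕ → ℕ) :
    kPromo μ q T = partPromo μ (q - 1) T := by
  unfold kPromo
  generalize q - 1 = n
  induction n with
  | zero => rfl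
  | succ n ih => rw [List.range_succ, List.foldl_append, ih]; rfl

theorem partPromo_inc (hT : IsIncTab (rectCells a b) q T) (k : ℕ) (hk : k + 1 ≤ q) :
    IsIncTab (rectCells a b) q (partPromo (rectCells a b) k T) := by
  induction k with
  | zero => exact hT
  | succ k ih => exact kbk_inc (ih (by omega)) (by omega) hk

theorem partPromo_comm (μ : Finset (ℕ × ℕ)) (T : ℕ × ℕ → ℕ) (k j : ℕ) (h : k + 1 < j) :
    partPromo μ k (kbkMap μ j T) = kbkMap μ j (partPromo μ k T) := by
  induction k with
  | zero => rfl
  | succ k ih =>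
    simp only [partPromo]
    rw [ih (by omega), kbk_comm _ _ h]

theorem desc_below (T : ℕ × ℕ → ℕ) (k j : ℕ) (h : k + 1 < j) :
    DescentAt a b (partPromo (rectCells a b) k T) j ↔ DescentAt a b T j := by
  induction k with
  | zero => rfl
  | succ k ih => rw [partPromo, desc_far _ (by omega), ih (by omega)]

theorem desc_above (T : ℕ × ℕ → ℕ) (j m : ℕ) :
    DescentAt a b (partPromo (rectCells a b) (j + 1 + m) T) j ↔
      DescentAt a b (partPromo (rectCells a b) (j + 1) T) j := by
  induction m with
  | zero => rfl
  | succ m ih => rw [← add_assoc, partPromo, desc_far _ (by omega), ih]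

theorem first_iff (hT : IsIncTab (rectCells a b) q T) (hq : 2 ≤ q) :
    DescentAt a b T 1 ↔ DescentAt a b (kbkMap (rectCells a b) 1 T) 1 := by
  refine ⟨first_aux hT, fun h => ?_⟩
  have := first_aux (kbk_inc hT le_rfl hq) h
  rwa [kbk_invol hT] at this

theorem last_iff {n : ℕ} (hT : IsIncTab (rectCells a b) (n + 1) T) (hn : 1 ≤ n) :
    DescentAt a b T n ↔ DescentAt a b (kbkMap (rectCells a b) n T) n := by
  refine ⟨last_aux hT, fun h => ?_⟩
  have := last_aux (kbk_inc hT hn le_rfl) h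
  rwa [kbk_invol hT] at this

theorem double_iff (hT : IsIncTab (rectCells a b) q T) (k : ℕ) (hk : k + 2 ≤ q) :
    DescentAt a b T 1 ↔ DescentAt a b
      (partPromo (rectCells a b) k (partPromo (rectCells a b) (k + 1) T)) (k + 1) := by
  induction k with
  | zero => exact first_iff hT hk
  | succ k ih =>
    rw [ih (by omega), local_iff2 (partPromo_inc (partPromo_inc hT _ (by omega)) _ (by omega))
      (by omega) (by omega), ← partPromo_comm _ _ _ _ (by omega)]
    rfl

end helpers

/-- Proposition 2.7 (descent cycling): `i` is a descent of `T ∈ Inc^q(a×b)` if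
and only if `i - 1` (mod `q`, i.e. `q` when `i = 1`) is a descent of `∂(T)`. -/
theorem descent_cycling (a b q : ℕ) (ha : 0 < a) (hb : 0 < b) (hq : 0 < q)
    (T : ℕ × ℕ → ℕ) (hT : IsIncTab (rectCells a b) q T)
    (i : ℕ) (hi1 : 1 ≤ i) (hiq : i ≤ q) :
    IsDescent a b q T i ↔
      IsDescent a b q (kPromo (rectCells a b) q T) (if i = 1 then q else i - 1) := by
  have hP := kPromo_eq (rectCells a b) q
  rcases Nat.lt_or_ge q 2 with h | h
  · have h1 : q = 1 := by omega
    subst h1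
    have h2 : i = 1 := by omega
    subst h2
    simp [IsDescent, hP, partPromo]
  · by_cases hi : i = 1
    · subst hi
      obtain ⟨n, rfl⟩ : ∃ n, q = n + 2 := ⟨q - 2, by omega⟩
      unfold IsDescent
      rw [if_neg (by omega), if_pos rfl, if_pos rfl, hP, hP]
      have e1 : n + 2 - 1 = n + 1 := by omega
      rw [e1, double_iff hT n le_rfl]
      exact last_iff (partPromo_inc (partPromo_inc hT _ (by omega)) _ (by omega)) (by omega)
    · rw [if_neg hi]
      unfold IsDescent
      rw [if_neg (c := i - 1 = q) (by omega)]
      by_cases hiq' : i = q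
      · rw [if_pos hiq', hiq']
      · rw [if_neg hiq', hP]
        obtain ⟨j, rfl⟩ : ∃ j, i = j + 2 := ⟨i - 2, by omega⟩
        obtain ⟨m, hm⟩ : ∃ m, q - 1 = j + 1 + 1 + m := ⟨q - 1 - (j + 2), by omega⟩
        have e1 : j + 2 - 1 = j + 1 := by omega
        rw [e1, hm, desc_above, ← desc_below T j (j + 2) (by omega)]
        exact local_iff1 (partPromo_inc hT _ (by omega)) (by omega) (by omega)
end

section
/- Let T ∈ Inc^q(a×b) and suppose 1 ≤ i < q is both a descent and a transpose descent of T. Then the number of cells of T containing i plus the number of cells containing i+1 is at least 3. -/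
open scoped Classical

/-- Lemma 2.10: if `1 ≤ i < q` is both a descent and a transpose descent of
`T ∈ Inc^q(a×b)`, then the number of cells containing `i` plus the number of
cells containing `i+1` is at least `3`. -/
theorem three_for_two (a b q : ℕ) (ha : 0 < a) (hb : 0 < b)
    (T : ℕ × ℕ → ℕ) (hT : IsIncTab (rectCells a b) q T)
    (i : ℕ) (hi1 : 1 ≤ i) (hiq : i < q)
    (hdes : DescentAt a b T i) (htdes : TDescentAt a b T i) :
    3 ≤ ((rectCells a b).filter (fun c => T c = i)).card +
        ((rectCells a b).filter (fun c => T c = i + 1)).card := by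
  obtain ⟨c, hc, d, hd, hci, hdi, hcd⟩ := hdes
  obtain ⟨c', hc', d', hd', hci', hdi', hcd'⟩ := htdes
  by_contra hlt
  have mc : c ∈ (rectCells a b).filter (fun c => T c = i) := Finset.mem_filter.2 ⟨hc, hci⟩
  have mc' : c' ∈ (rectCells a b).filter (fun c => T c = i) := Finset.mem_filter.2 ⟨hc', hci'⟩
  have md : d ∈ (rectCells a b).filter (fun c => T c = i + 1) := Finset.mem_filter.2 ⟨hd, hdi⟩
  have md' : d' ∈ (rectCells a b).filter (fun c => T c = i + 1) :=
    Finset.mem_filter.2 ⟨hd', hdi'⟩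
  have p1 := Finset.card_pos.2 ⟨c, mc⟩
  have p2 := Finset.card_pos.2 ⟨d, md⟩
  have e1 : c = c' := Finset.card_le_one.1 (by omega) c mc c' mc'
  have e2 : d = d' := Finset.card_le_one.1 (by omega) d md d' md'
  subst e1 e2
  have he : (c.1, d.2) ∈ rectCells a b := by
    simp only [rectCells, Finset.mem_product, Finset.mem_range] at hc hd ⊢
    exact ⟨hc.1, hd.2⟩
  have h1 := hT.2.1 c hc (c.1, d.2) he rfl hcd'
  have h2 := hT.2.2 (c.1, d.2) he d hd rfl hcd
  omega
end

section
/- For all positive integers a and b, the order of rowmotion Row on J(𝐚×𝐛), the set of order ideals of the product of two chains Fin a × Fin b, is exactly a + b; that is, the least m > 0 with Row^m equal to the identity on J(𝐚×𝐛) is a + b. -/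
/-- Rowmotion on order ideals (lower sets) of a poset `P`: `I` is sent to the
order ideal generated by the minimal elements of the complement of `I`. -/
def rowmo {P : Type*} [PartialOrder P] (I : Set P) : Set P :=
  {x | ∃ m, Minimal (fun y => y ∉ I) m ∧ x ≤ m}

/-- Membership of a pair of naturals in a set of pairs in `Fin a × Fin b`. -/
def RmMem {a b : ℕ} (I : Set (Fin a × Fin b)) (x y : ℕ) : Prop :=
  ∃ (hx : x < a) (hy : y < b), ((⟨x, hx⟩, ⟨y, hy⟩) : Fin a × Fin b) ∈ I

/-- `f` is the column height function of `I`. -/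
def RmRep {a b : ℕ} (I : Set (Fin a × Fin b)) (f : ℕ → ℕ) : Prop :=
  ∀ x y, RmMem I x y ↔ y < f x

theorem rm_exists_rep {a b : ℕ} (I : Set (Fin a × Fin b)) (hI : IsLowerSet I) :
    ∃ f, RmRep I f := by
  classical
  have h : ∀ x, ∃ y, ¬ RmMem I x y := fun x => ⟨b, by rintro ⟨_, h, _⟩; omega⟩
  refine ⟨fun x => Nat.find (h x), fun x y => ?_⟩
  rw [Nat.lt_find_iff]
  constructor
  · rintro ⟨hx, hy, hm⟩ z hz
    rw [not_not]
    refine ⟨hx, by omega, hI ?_ hm⟩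
    exact ⟨le_refl _, hz⟩
  · intro h
    simpa using h y le_rfl

theorem rm_antitone {a b : ℕ} {I : Set (Fin a × Fin b)} (hI : IsLowerSet I) {f : ℕ → ℕ}
    (hf : RmRep I f) : Antitone f := by
  intro x x' hxx
  by_contra hlt
  push Not at hlt
  obtain ⟨hx, hy, hm⟩ := (hf x' (f x)).2 hlt
  have hle : ((⟨x, by omega⟩, ⟨f x, hy⟩) : Fin a × Fin b) ≤ (⟨x', hx⟩, ⟨f x, hy⟩) :=
    ⟨hxx, le_refl _⟩
  have : RmMem I x (f x) := ⟨by omega, hy, hI hle hm⟩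
  have := (hf _ _).1 this
  omega

theorem rm_le {a b : ℕ} {I : Set (Fin a × Fin b)} {f : ℕ → ℕ}
    (hf : RmRep I f) (x : ℕ) : f x ≤ b := by
  by_contra hlt
  push Not at hlt
  obtain ⟨_, h, _⟩ := (hf x b).2 hlt
  omega

theorem rm_zero {a b : ℕ} {I : Set (Fin a × Fin b)} {f : ℕ → ℕ}
    (hf : RmRep I f) (x : ℕ) (hx : a ≤ x) : f x = 0 := by
  by_contra hlt
  obtain ⟨h, _, _⟩ := (hf x 0).2 (by omega)
  omega

theorem rm_lower {P : Type*} [PartialOrder P] (I : Set P) : IsLowerSet (rowmo I) := by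
  rintro x y hxy ⟨m, hm, h⟩
  exact ⟨m, hm, hxy.trans h⟩

/-- there is a minimal element of the complement in column `x`. -/
def RmCond (b : ℕ) (f : ℕ → ℕ) (x : ℕ) : Prop :=
  f x < b ∧ (0 < x → f x < f (x - 1))

theorem rm_minimal {a b : ℕ} {I : Set (Fin a × Fin b)} (hI : IsLowerSet I) {f : ℕ → ℕ}
    (hf : RmRep I f) (x y : ℕ) (hx : x < a) (hy : y < b) :
    Minimal (fun z => z ∉ I) ((⟨x, hx⟩, ⟨y, hy⟩) : Fin a × Fin b) ↔
      y = f x ∧ RmCond b f x := by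
  have key : ∀ (u v : ℕ) (hu : u < a) (hv : v < b),
      ((⟨u, hu⟩, ⟨v, hv⟩) : Fin a × Fin b) ∉ I ↔ f u ≤ v := by
    intro u v hu hv
    rw [← not_lt, ← hf u v, not_iff_not]
    exact ⟨fun h => ⟨hu, hv, h⟩, fun ⟨_, _, h⟩ => h⟩
  have anti := rm_antitone hI hf
  constructor
  · rintro ⟨h1, h2⟩
    have h1 := (key _ _ _ _).1 h1
    have e : y = f x := by
      have := @h2 (⟨x, hx⟩, ⟨f x, by omega⟩) ((key _ _ _ _).2 le_rfl) ⟨le_refl _, h1⟩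
      have := this.2
      simp at this
      omega
    refine ⟨e, by omega, fun hx0 => ?_⟩
    by_contra hlt
    have := @h2 (⟨x - 1, by omega⟩, ⟨y, hy⟩) ((key _ _ _ _).2 (by omega))
      ⟨by simp, le_refl _⟩
    have := this.1
    simp at this
    omega
  · rintro ⟨rfl, h1, h2⟩
    refine ⟨(key _ _ _ _).2 le_rfl, ?_⟩
    rintro ⟨⟨u, hu⟩, ⟨v, hv⟩⟩ h ⟨hu', hv'⟩
    have h := (key _ _ _ _).1 h
    simp at hu' hv'
    have hux : u = x := by
      by_contra hne
      have := h2 (by omega)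
      have := anti (show u ≤ x - 1 by omega)
      omega
    subst hux
    exact ⟨le_refl _, h⟩

theorem rm_step {a b : ℕ} {I : Set (Fin a × Fin b)} (hI : IsLowerSet I) {f g : ℕ → ℕ}
    (hf : RmRep I f) (hg : RmRep (rowmo I) g) (x y : ℕ) :
    y < g x ↔ ∃ x', x ≤ x' ∧ x' < a ∧ RmCond b f x' ∧ y ≤ f x' := by
  rw [← hg x y]
  constructor
  · rintro ⟨hx, hy, ⟨⟨u, hu⟩, ⟨v, hv⟩⟩, hm, h1, h2⟩
    rw [rm_minimal hI hf] at hm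
    simp at h1 h2
    obtain ⟨rfl, hc⟩ := hm
    exact ⟨u, h1, hu, hc, h2⟩
  · rintro ⟨u, h1, hu, hc, h2⟩
    exact ⟨by omega, lt_of_le_of_lt h2 hc.1, (⟨u, hu⟩, ⟨f u, hc.1⟩),
      (rm_minimal hI hf _ _ _ _).2 ⟨rfl, hc⟩, h1, h2⟩

/-- The Stanley–Thomas word. -/
def RmW (a : ℕ) (f : ℕ → ℕ) (i : ℕ) : Prop :=
  (i < a ∧ f (i + 1) < f i) ∨ (a ≤ i ∧ ∀ x, f x ≠ i - a + 1)

theorem rm_row {a b : ℕ} {I : Set (Fin a × Fin b)} (hI : IsLowerSet I) {f g : ℕ → ℕ}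
    (hf : RmRep I f) (hg : RmRep (rowmo I) g) (x : ℕ) (hx : x < a) :
    g (x + 1) < g x ↔ RmCond b f x := by
  have anti := rm_antitone hI hf
  constructor
  · intro h
    obtain ⟨u, h1, h2, h3, h4⟩ := (rm_step hI hf hg x (g (x + 1))).1 h
    by_cases hux : u = x
    · rwa [hux] at h3
    · have := (rm_step hI hf hg (x + 1) (g (x + 1))).2 ⟨u, by omega, h2, h3, h4⟩
      omega
  · intro hc
    have h1 := (rm_step hI hf hg x (f x)).2 ⟨x, le_rfl, hx, hc, le_rfl⟩
    have h2 : ¬ f x < g (x + 1) := by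
      rw [rm_step hI hf hg]
      rintro ⟨u, h1, h2, h3, h4⟩
      have := h3.2 (by omega)
      have := anti (show x ≤ u - 1 by omega)
      omega
    omega

theorem rm_col {a b : ℕ} {I : Set (Fin a × Fin b)} (hI : IsLowerSet I) {f g : ℕ → ℕ}
    (hf : RmRep I f) (hg : RmRep (rowmo I) g) (v : ℕ) (hv : v < b) :
    (∃ x, g x = v + 1) ↔ ∃ x, x < a ∧ f x = v := by
  classical
  have anti := rm_antitone hI hf
  constructor
  · rintro ⟨x, hx⟩
    obtain ⟨u, h1, h2, h3, h4⟩ := (rm_step hI hf hg x v).1 (by omega)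
    refine ⟨u, h2, ?_⟩
    by_contra hne
    have := (rm_step hI hf hg x (v + 1)).2 ⟨u, h1, h2, h3, by omega⟩
    omega
  · intro h
    obtain ⟨h1, h2⟩ := Nat.find_spec h
    have hmin := fun m (hm : m < Nat.find h) => Nat.find_min h hm
    set x := Nat.find h
    have hc : RmCond b f x := by
      refine ⟨by omega, fun h0 => ?_⟩
      have := hmin (x - 1) (by omega)
      have := anti (show x - 1 ≤ x by omega)
      by_contra hlt
      exact hmin (x - 1) (by omega) ⟨by omega, by omega⟩
    refine ⟨x, ?_⟩
    have h3 := (rm_step hI hf hg x v).2 ⟨x, le_rfl, h1, hc, by omega⟩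
    have h4 : ¬ v + 1 < g x := by
      rw [rm_step hI hf hg]
      rintro ⟨u, h5, h6, h7, h8⟩
      have := anti h5
      omega
    omega

theorem rm_W_succ {a b : ℕ} {I : Set (Fin a × Fin b)} (hI : IsLowerSet I) {f g : ℕ → ℕ}
    (hf : RmRep I f) (hg : RmRep (rowmo I) g) (i : ℕ) (hi : i + 1 < a + b) (ha : 0 < a) :
    RmW a g (i + 1) ↔ RmW a f i := by
  have anti := rm_antitone hI hf
  have hz := rm_zero hf
  unfold RmW
  rcases lt_trichotomy (i + 1) a with h | h | h
  · have := rm_row hI hf hg (i + 1) h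
    have h2 := rm_le hf i
    simp only [RmCond, Nat.add_sub_cancel] at this
    constructor
    · rintro (⟨_, h1⟩ | ⟨h1, _⟩)
      · exact Or.inl ⟨by omega, (this.1 h1).2 (by omega)⟩
      · omega
    · rintro (⟨_, h1⟩ | ⟨h1, _⟩)
      · exact Or.inl ⟨h, this.2 ⟨by omega, fun _ => h1⟩⟩
      · omega
  · have := rm_col hI hf hg 0 (by omega)
    have h0 := hz (i + 1) (by omega)
    constructor
    · rintro (⟨_, h1⟩ | ⟨_, h1⟩)
      · omega
      · refine Or.inl ⟨by omega, ?_⟩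
        by_contra hlt
        obtain ⟨x, hx⟩ := this.2 ⟨i, by omega, by omega⟩
        exact h1 x (by omega)
    · rintro (⟨_, h1⟩ | ⟨h1, _⟩)
      · refine Or.inr ⟨by omega, fun x hx => ?_⟩
        obtain ⟨u, hu, hu'⟩ := this.1 ⟨x, by omega⟩
        have := anti (show u ≤ i by omega)
        omega
      · omega
  · have := rm_col hI hf hg (i - a + 1) (by omega)
    constructor
    · rintro (⟨_, h1⟩ | ⟨_, h1⟩)
      · omega
      · refine Or.inr ⟨by omega, fun x hx => ?_⟩
        have hxa : x < a := by
          by_contra hh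
          have := hz x (by omega)
          omega
        obtain ⟨u, hu⟩ := this.2 ⟨x, hxa, hx⟩
        exact h1 u (by omega)
    · rintro (⟨_, h1⟩ | ⟨_, h1⟩)
      · omega
      · refine Or.inr ⟨by omega, fun x hx => ?_⟩
        obtain ⟨u, hu, hu'⟩ := this.1 ⟨x, by omega⟩
        exact h1 u hu'

theorem rm_W_zero {a b : ℕ} {I : Set (Fin a × Fin b)} (hI : IsLowerSet I) {f g : ℕ → ℕ}
    (hf : RmRep I f) (hg : RmRep (rowmo I) g) (ha : 0 < a) (hb : 0 < b) :
    RmW a g 0 ↔ RmW a f (a + b - 1) := by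
  have anti := rm_antitone hI hf
  have hr := rm_row hI hf hg 0 ha
  unfold RmW
  constructor
  · rintro (⟨_, h1⟩ | ⟨h1, _⟩)
    · have h2 := (hr.1 h1).1
      refine Or.inr ⟨by omega, fun x hx => ?_⟩
      have := anti (Nat.zero_le x)
      omega
    · omega
  · rintro (⟨h1, _⟩ | ⟨_, h1⟩)
    · omega
    · have h2 := h1 0
      have h3 := rm_le hf 0
      exact Or.inl ⟨ha, hr.2 ⟨by omega, fun h => by omega⟩⟩

theorem rm_inj_aux {a b : ℕ} {I J : Set (Fin a × Fin b)} (hJ : IsLowerSet J) {f g : ℕ → ℕ}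
    (hf : RmRep I f) (hg : RmRep J g)
    (hW : ∀ i, i < a + b → (RmW a g i ↔ RmW a f i)) (x : ℕ) (h : f (x + 1) = g (x + 1))
    (hlt : f (x + 1) < f x) : g x ≤ f x := by
  have hb := rm_le hf x
  have h1 : ¬ RmW a f (a + (f x - 1)) := by
    rintro (⟨h1, _⟩ | ⟨_, h1⟩)
    · omega
    · exact h1 x (by omega)
  rw [← hW _ (by omega)] at h1
  simp only [RmW, not_or, not_and, not_forall, not_not] at h1
  obtain ⟨u, hu⟩ := h1.2 (by omega)
  have anti := rm_antitone hJ hg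
  by_cases hux : u ≤ x
  · have := anti hux
    omega
  · have := anti (show x + 1 ≤ u by omega)
    omega

theorem rm_inj {a b : ℕ} {I J : Set (Fin a × Fin b)} (hI : IsLowerSet I) (hJ : IsLowerSet J)
    {f g : ℕ → ℕ} (hf : RmRep I f) (hg : RmRep J g)
    (hW : ∀ i, i < a + b → (RmW a g i ↔ RmW a f i)) : I = J := by
  have key : ∀ k x, a ≤ x + k → f x = g x := by
    intro k
    induction k with
    | zero => intro x hx; rw [rm_zero hf x hx, rm_zero hg x hx]
    | succ k ih =>
      intro x hx
      by_cases hxa : a ≤ x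
      · rw [rm_zero hf x hxa, rm_zero hg x hxa]
      have h := ih (x + 1) (by omega)
      have hw : g (x + 1) < g x ↔ f (x + 1) < f x := by
        have := hW x (by omega)
        simpa [RmW, hxa, not_le.1 hxa] using this
      have fa := rm_antitone hI hf (show x ≤ x + 1 by omega)
      have ga := rm_antitone hJ hg (show x ≤ x + 1 by omega)
      by_cases hlt : f (x + 1) < f x
      · have h1 := rm_inj_aux hJ hf hg hW x h hlt
        have h2 := rm_inj_aux hI hg hf (fun i hi => (hW i hi).symm) x h.symm (hw.2 hlt)
        omega
      · have := mt hw.1 hlt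
        omega
  ext ⟨⟨x, hx⟩, ⟨y, hy⟩⟩
  have h1 := hf x y
  have h2 := hg x y
  rw [key a x (by omega), ← h2] at h1
  simpa [RmMem, hx, hy] using h1

theorem rm_period {a b : ℕ} (ha : 0 < a) (hb : 0 < b) (I : Set (Fin a × Fin b))
    (hI : IsLowerSet I) : rowmo^[a + b] I = I := by
  have hl : ∀ n, IsLowerSet (rowmo^[n] I) := by
    intro n
    cases n with
    | zero => exact hI
    | succ n => rw [Function.iterate_succ_apply']; exact rm_lower _
  choose f hf using fun n => rm_exists_rep _ (hl n)
  have hf' : ∀ n, RmRep (rowmo (rowmo^[n] I)) (f (n + 1)) := by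
    intro n
    have := hf (n + 1)
    rwa [Function.iterate_succ_apply'] at this
  have shift : ∀ k n i, i + k < a + b → (RmW a (f (n + k)) (i + k) ↔ RmW a (f n) i) := by
    intro k
    induction k with
    | zero => intro n i _; rfl
    | succ k ih =>
      intro n i h
      rw [← ih n i (by omega)]
      exact rm_W_succ (hl _) (hf _) (hf' (n + k)) (i + k) (by omega) ha
  refine (rm_inj hI (hl _) (hf 0) (hf (a + b)) fun i hi => ?_).symm
  have h1 := shift i (a + b - i) 0 (by omega)
  have h2 := rm_W_zero (hl _) (hf _) (hf' (a + b - i - 1)) ha hb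
  have h3 := shift (a + b - 1 - i) 0 i (by omega)
  rw [show a + b - i + i = a + b by omega, show 0 + i = i by omega] at h1
  rw [show a + b - i - 1 + 1 = a + b - i by omega] at h2
  rw [show 0 + (a + b - 1 - i) = a + b - i - 1 by omega,
    show i + (a + b - 1 - i) = a + b - 1 by omega] at h3
  exact h1.trans (h2.trans h3)

theorem rm_rank {a b : ℕ} (n : ℕ) (p : Fin a × Fin b)
    (hp : p ∈ rowmo^[n] (∅ : Set (Fin a × Fin b))) : p.1.1 + p.2.1 < n := by
  induction n generalizing p with
  | zero => exact hp.elim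
  | succ n ih =>
    rw [Function.iterate_succ_apply'] at hp
    obtain ⟨⟨⟨u, hu⟩, ⟨v, hv⟩⟩, hm, h1, h2⟩ := hp
    have h1 : p.1.1 ≤ u := h1
    have h2 : p.2.1 ≤ v := h2
    suffices u + v < n + 1 by omega
    by_contra hlt
    by_cases hu0 : 0 < u
    · have := hm.2 (y := (⟨u - 1, by omega⟩, ⟨v, hv⟩))
        (fun h => by have := ih _ h; simp at this; omega) ⟨by simp, le_refl _⟩
      have := this.1
      simp at this
      omega
    · by_cases hv0 : 0 < v
      · have := hm.2 (y := (⟨u, hu⟩, ⟨v - 1, by omega⟩))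
          (fun h => by have := ih _ h; simp at this; omega) ⟨le_refl _, by simp⟩
        have := this.2
        simp at this
        omega
      · omega

/-- Theorem 3.1 (Brouwer–Schrijver): the order of rowmotion on
`J(𝐚 × 𝐛)`, the order ideals of the product of two chains, is exactly `a + b`. -/
theorem order_rowmotion_two_chains (a b : ℕ) (ha : 0 < a) (hb : 0 < b) :
    IsLeast {m : ℕ | 0 < m ∧
      ∀ I : Set (Fin a × Fin b), IsLowerSet I → rowmo^[m] I = I} (a + b) := by
  refine ⟨⟨by omega, fun I hI => rm_period ha hb I hI⟩, ?_⟩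
  rintro m ⟨hm, h⟩
  by_contra hlt
  obtain ⟨n, rfl⟩ : ∃ n, m = n + 1 := ⟨m - 1, by omega⟩
  have h0 := h ∅ isLowerSet_empty
  rw [Function.iterate_succ_apply'] at h0
  have htop : ((⟨a - 1, by omega⟩, ⟨b - 1, by omega⟩) : Fin a × Fin b) ∉
      rowmo^[n] (∅ : Set (Fin a × Fin b)) := by
    intro hp
    have := rm_rank n _ hp
    simp at this
    omega
  obtain ⟨q, _, hq⟩ := exists_minimal_le_of_wellFoundedLT
    (fun y => y ∉ rowmo^[n] (∅ : Set (Fin a × Fin b))) _ htop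
  have : q ∈ rowmo (rowmo^[n] (∅ : Set (Fin a × Fin b))) := ⟨q, hq, le_rfl⟩
  rw [h0] at this
  exact this
end

section
/- Let P be a finite ranked poset with an n-dimensional lattice projection π, and let v ∈ {−1,1}ⁿ. If x, y ∈ P satisfy ⟨π(x), v⟩ = ⟨π(y), v⟩ (they lie on the same affine hyperplane with respect to v), then y does not cover x in P. Consequently, the toggles t_x and t_y commute, and for each i ∈ ℤ the hyperplane toggle T^i_{π,v} is a well-defined involution of J(P). -/
open scoped Classical

/-- The toggle `t_e` on subsets of a poset: add `e` if the result is an order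
ideal, remove `e` if the result is an order ideal, otherwise do nothing. -/
noncomputable def tog {P : Type*} [PartialOrder P] (e : P) (I : Set P) : Set P :=
  if e ∉ I ∧ IsLowerSet (I ∪ {e}) then I ∪ {e}
  else if e ∈ I ∧ IsLowerSet (I \ {e}) then I \ {e}
  else I

/-- The composition `tog L[0] ∘ tog L[1] ∘ ⋯` of the toggles indexed by a list. -/
noncomputable def togList {P : Type*} [PartialOrder P] (L : List P) : Set P → Set P :=
  L.foldr (fun e f => tog e ∘ f) id

theorem tog_lower {P : Type*} [PartialOrder P] (e : P) (I : Set P) (hI : IsLowerSet I) :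
    IsLowerSet (tog e I) := by
  unfold tog
  split_ifs with h1 h2
  · exact h1.2
  · exact h2.2
  · exact hI

theorem lower_union_iff {P : Type*} [Fintype P] [PartialOrder P] (e : P) (I : Set P)
    (hI : IsLowerSet I) : IsLowerSet (I ∪ {e}) ↔ ∀ a, a ⋖ e → a ∈ I := by
  constructor
  · intro h a ha
    rcases h ha.le (Or.inr rfl) with h | h
    · exact h
    · exact absurd h ha.lt.ne
  · rintro h a b hba (ha | rfl)
    · exact Or.inl (hI hba ha)
    · rcases hba.eq_or_lt with rfl | hlt
      · exact Or.inr rfl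
      · obtain ⟨c, hbc, hc⟩ := exists_le_covBy_of_lt hlt
        exact Or.inl (hI hbc (h c hc))

theorem lower_diff_iff {P : Type*} [Fintype P] [PartialOrder P] (e : P) (I : Set P)
    (hI : IsLowerSet I) : IsLowerSet (I \ {e}) ↔ ∀ b, e ⋖ b → b ∉ I := by
  constructor
  · intro h b hb hbI
    exact (h hb.le ⟨hbI, hb.lt.ne'⟩).2 rfl
  · rintro h a b hba ⟨ha, hae⟩
    refine ⟨hI hba ha, ?_⟩
    rintro rfl
    have hlt : b < a := lt_of_le_of_ne hba (fun h => hae h.symm)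
    obtain ⟨c, hc, hca⟩ := exists_covBy_le_of_lt hlt
    exact h c hc (hI hca ha)

theorem mem_tog_ne {P : Type*} [PartialOrder P] (e z : P) (I : Set P) (h : z ≠ e) :
    z ∈ tog e I ↔ z ∈ I := by
  unfold tog
  split_ifs <;> simp [h]

theorem mem_tog_self {P : Type*} [Fintype P] [PartialOrder P] (e : P) (I : Set P)
    (hI : IsLowerSet I) :
    e ∈ tog e I ↔ (e ∉ I ∧ ∀ a, a ⋖ e → a ∈ I) ∨ (e ∈ I ∧ ¬ ∀ b, e ⋖ b → b ∉ I) := by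
  unfold tog
  rw [lower_union_iff e I hI, lower_diff_iff e I hI]
  split_ifs with h1 h2
  · exact ⟨fun _ => Or.inl h1, fun _ => Or.inr rfl⟩
  · simp only [Set.mem_sdiff, Set.mem_singleton_iff]; tauto
  · tauto

theorem tog_comm_aux {P : Type*} [Fintype P] [PartialOrder P] (x y : P) (hne : x ≠ y)
    (h1 : ¬ x ⋖ y) (h2 : ¬ y ⋖ x) (I : Set P) (hI : IsLowerSet I) :
    x ∈ tog x (tog y I) ↔ x ∈ tog x I := by
  rw [mem_tog_self x _ (tog_lower y I hI), mem_tog_self x I hI, mem_tog_ne y x I hne]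
  have ha : ∀ a, a ⋖ x → (a ∈ tog y I ↔ a ∈ I) := fun a hcov =>
    mem_tog_ne y a I (by rintro rfl; exact h2 hcov)
  have hb : ∀ a, x ⋖ a → (a ∈ tog y I ↔ a ∈ I) := fun a hcov =>
    mem_tog_ne y a I (by rintro rfl; exact h1 hcov)
  rw [forall₂_congr ha, forall₂_congr (fun a h => not_congr (hb a h))]

theorem tog_comm {P : Type*} [Fintype P] [PartialOrder P] (x y : P)
    (h1 : ¬ x ⋖ y) (h2 : ¬ y ⋖ x) (I : Set P) (hI : IsLowerSet I) :
    tog x (tog y I) = tog y (tog x I) := by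
  by_cases hne : x = y
  · rw [hne]
  ext z
  by_cases hx : z = x
  · subst hx
    rw [tog_comm_aux z y hne h1 h2 I hI, mem_tog_ne y z _ hne]
  · by_cases hy : z = y
    · subst hy
      rw [tog_comm_aux z x hx h2 h1 I hI, mem_tog_ne x z _ hx]
    · rw [mem_tog_ne x z _ hx, mem_tog_ne y z _ hy, mem_tog_ne y z _ hy, mem_tog_ne x z _ hx]

theorem tog_tog {P : Type*} [Fintype P] [PartialOrder P] (e : P) (I : Set P)
    (hI : IsLowerSet I) : tog e (tog e I) = I := by
  ext z
  by_cases hz : z = e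
  · subst hz
    have ha : ∀ a, a ⋖ z → (a ∈ tog z I ↔ a ∈ I) := fun a hcov =>
      mem_tog_ne z a I hcov.lt.ne
    have hb : ∀ a, z ⋖ a → (a ∈ tog z I ↔ a ∈ I) := fun a hcov =>
      mem_tog_ne z a I hcov.lt.ne'
    rw [mem_tog_self z _ (tog_lower z I hI), mem_tog_self z I hI,
      forall₂_congr ha, forall₂_congr (fun a h => not_congr (hb a h))]
    have hl : z ∈ I → ∀ a, a ⋖ z → a ∈ I := fun h a ha => hI ha.le h
    have hu : z ∉ I → ∀ b, z ⋖ b → b ∉ I := fun h b hb hbI => h (hI hb.le hbI)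
    tauto
  · rw [mem_tog_ne e z _ hz, mem_tog_ne e z _ hz]

theorem togList_cons {P : Type*} [PartialOrder P] (e : P) (L : List P) (I : Set P) :
    togList (e :: L) I = tog e (togList L I) := rfl

theorem togList_lower {P : Type*} [PartialOrder P] (L : List P) (I : Set P)
    (hI : IsLowerSet I) : IsLowerSet (togList L I) := by
  induction L with
  | nil => exact hI
  | cons e L ih => exact tog_lower e _ ih

theorem togList_perm {P : Type*} [Fintype P] [PartialOrder P] {L L' : List P}
    (hp : L.Perm L') (hc : ∀ x ∈ L, ∀ y ∈ L, ¬ x ⋖ y) (I : Set P) (hI : IsLowerSet I) :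
    togList L I = togList L' I := by
  induction hp with
  | nil => rfl
  | cons x _ ih =>
    rw [togList_cons, togList_cons,
      ih (fun a ha b hb => hc a (List.mem_cons_of_mem _ ha) b (List.mem_cons_of_mem _ hb))]
  | swap x y l =>
    simp only [togList_cons]
    exact tog_comm y x (hc y (by simp) x (by simp)) (hc x (by simp) y (by simp)) _
      (togList_lower l I hI)
  | trans p1 _ ih1 ih2 =>
    rw [ih1 hc]
    exact ih2 (fun a ha b hb => hc a (p1.mem_iff.2 ha) b (p1.mem_iff.2 hb))

theorem togList_tog {P : Type*} [Fintype P] [PartialOrder P] (e : P) (L : List P)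
    (hc : ∀ x ∈ L, ¬ x ⋖ e ∧ ¬ e ⋖ x) (I : Set P) (hI : IsLowerSet I) :
    togList L (tog e I) = tog e (togList L I) := by
  induction L with
  | nil => rfl
  | cons x L ih =>
    rw [togList_cons, togList_cons, ih (fun a ha => hc a (List.mem_cons_of_mem _ ha))]
    exact tog_comm x e (hc x (by simp)).1 (hc x (by simp)).2 _ (togList_lower L I hI)

theorem togList_invol {P : Type*} [Fintype P] [PartialOrder P] (L : List P)
    (hc : ∀ x ∈ L, ∀ y ∈ L, ¬ x ⋖ y) (I : Set P) (hI : IsLowerSet I) :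
    togList L (togList L I) = I := by
  induction L with
  | nil => rfl
  | cons e L ih =>
    rw [togList_cons, togList_cons, togList_tog e L (fun x hx =>
      ⟨hc x (List.mem_cons_of_mem _ hx) e (by simp), hc e (by simp) x (List.mem_cons_of_mem _ hx)⟩)
      _ (togList_lower L I hI),
      ih (fun a ha b hb => hc a (List.mem_cons_of_mem _ ha) b (List.mem_cons_of_mem _ hb)),
      tog_tog e I hI]

/-- Lemma 3.7: if `P` is a finite ranked poset with an `n`-dimensional lattice
projection `π` and `v ∈ {±1}ⁿ`, then two elements lying on the same affine
hyperplane `⟨π(x), v⟩ = i` cannot form a covering relation; consequently their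
toggles commute (on `J(P)`), and for every `i ∈ ℤ` the hyperplane toggle
`T^i_{π,v}` — the composition of the toggles of all elements of the hyperplane,
in any order — is a well-defined involution of `J(P)`. -/
theorem hyperplane_toggles (P : Type*) [Fintype P] [PartialOrder P] (n : ℕ)
    (π : P → Fin n → ℤ) (rk : P → ℤ)
    (hmono : Monotone π)
    (hrk : ∀ x y : P, x ⋖ y → rk y = rk x + 1)
    (hsum : ∀ x : P, (∑ j, π x j) = rk x)
    (v : Fin n → ℤ) (hv : ∀ j, v j = 1 ∨ v j = -1) :
    (∀ x y : P, (∑ j, π x j * v j) = (∑ j, π y j * v j) → ¬ x ⋖ y) ∧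
    (∀ x y : P, (∑ j, π x j * v j) = (∑ j, π y j * v j) →
      ∀ I : Set P, IsLowerSet I → tog x (tog y I) = tog y (tog x I)) ∧
    (∀ i : ℤ, ∀ L L' : List P, L.Nodup → L'.Nodup →
      (∀ x : P, x ∈ L ↔ (∑ j, π x j * v j) = i) →
      (∀ x : P, x ∈ L' ↔ (∑ j, π x j * v j) = i) →
      ∀ I : Set P, IsLowerSet I →
        togList L I = togList L' I ∧
        IsLowerSet (togList L I) ∧
        togList L (togList L I) = I) := by
  have key : ∀ x y : P, (∑ j, π x j * v j) = (∑ j, π y j * v j) → ¬ x ⋖ y := by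
    intro x y h hxy
    have par : ∀ z : P, (2 : ℤ) ∣ (∑ j, π z j * v j) - rk z := by
      intro z
      rw [← hsum z, ← Finset.sum_sub_distrib]
      refine Finset.dvd_sum fun j _ => ?_
      rcases hv j with h | h <;> rw [h] <;> omega
    have h1 := par x
    have h2 := par y
    have h3 := hrk x y hxy
    omega
  refine ⟨key, fun x y h I hI => tog_comm x y (key x y h) (key y x h.symm) I hI, ?_⟩
  intro i L L' hL hL' hm hm' I hI
  have hc : ∀ x ∈ L, ∀ y ∈ L, ¬ x ⋖ y := fun x hx y hy =>
    key x y (((hm x).1 hx).trans ((hm y).1 hy).symm)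
  refine ⟨togList_perm ?_ hc I hI, togList_lower L I hI, togList_invol L hc I hI⟩
  rw [List.perm_ext_iff_of_nodup hL hL']
  exact fun a => (hm a).trans (hm' a).symm
end

section
/- Let G be a group and g_1, …, g_n ∈ G elements satisfying g_i² = 1 for all i and (g_i g_j)² = 1 whenever |i − j| > 1. Then for any permutations σ and τ of {1,…,n}, the products g_{σ(1)} g_{σ(2)} ⋯ g_{σ(n)} and g_{τ(1)} g_{τ(2)} ⋯ g_{τ(n)} are conjugate in G. -/
theorem pc_isConj_comm {G : Type*} [Group G] (a b : G) : IsConj (a * b) (b * a) :=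
  isConj_iff.2 ⟨b, by group⟩

/-- Core induction: only commutation of distant factors is needed. -/
theorem pc_core {G : Type*} [Group G] (n : ℕ) : ∀ (g : ℕ → G)
    (_ : ∀ i j : ℕ, i + 1 < j → j < n → Commute (g i) (g j))
    (l : List ℕ) (_ : l.Nodup) (_ : ∀ x, x ∈ l ↔ x < n),
    IsConj (l.map g).prod ((List.range n).map g).prod := by
  induction n with
  | zero =>
    intro g _ l _ hm
    have : l = [] := List.eq_nil_iff_forall_not_mem.2 (fun x hx => by have := (hm x).1 hx; omega)
    subst this
    exact IsConj.refl _
  | succ n ih =>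
    intro g hc l hl hm
    obtain _ | n := n
    · have hp : l.Perm [0] := (List.perm_ext_iff_of_nodup hl (by simp)).2 (by intro x; simp [hm])
      rw [List.perm_singleton.1 hp]
      exact IsConj.refl _
    · obtain ⟨s, t, rfl⟩ := List.append_of_mem ((hm n).2 (by omega))
      have e1 : IsConj ((s ++ n :: t).map g).prod (((t ++ s).map g).prod * g n) := by
        have := pc_isConj_comm ((s.map g).prod * g n) (t.map g).prod
        simpa [mul_assoc] using this
      have hl2 : (n :: (t ++ s)).Nodup :=
        (List.Perm.nodup_iff (List.perm_middle.trans
          (List.Perm.cons n List.perm_append_comm))).1 hl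
      have hm2 : ∀ x, x ∈ n :: (t ++ s) ↔ x < n + 1 + 1 := by
        intro x; rw [← hm x]; simp; tauto
      generalize t ++ s = r at *
      refine e1.trans ?_
      have hmem : n + 1 ∈ r := by
        have := (hm2 (n + 1)).2 (by omega)
        simpa using this
      obtain ⟨u, v, rfl⟩ := List.append_of_mem hmem
      have hl3 : ((n + 1) :: n :: (u ++ v)).Nodup :=
        (List.Perm.nodup_iff ((List.Perm.cons n List.perm_middle).trans
          (List.Perm.swap _ _ _))).1 hl2
      have hm3 : ∀ x, x ∈ (n + 1) :: n :: (u ++ v) ↔ x < n + 1 + 1 := by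
        intro x; rw [← hm2 x]; simp; tauto
      have huv : ∀ x ∈ u ++ v, x < n := by
        intro x hx
        have h := (hm3 x).1 (by simp only [List.mem_cons]; tauto)
        have hn : x ≠ n := by
          rintro rfl
          simp only [List.nodup_cons] at hl3; tauto
        have hn1 : x ≠ n + 1 := by
          rintro rfl
          simp only [List.nodup_cons, List.mem_cons] at hl3; tauto
        omega
      have hcu : Commute (u.map g).prod (g (n + 1)) := by
        apply Commute.list_prod_left
        intro y hy
        obtain ⟨x, hx, rfl⟩ := List.mem_map.1 hy
        have := huv x (by simp [hx])
        exact hc x (n + 1) (by omega) (by omega)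
      have e2 : IsConj (((u ++ (n + 1) :: v).map g).prod * g n)
          (((u ++ v).map g).prod * (g n * g (n + 1))) := by
        have := pc_isConj_comm (g (n + 1)) ((u.map g).prod * ((v.map g).prod * g n))
        rw [← mul_assoc, ← hcu.eq] at this
        simpa [mul_assoc] using this
      refine e2.trans ?_
      set g' : ℕ → G := Function.update g n (g n * g (n + 1)) with hg'
      have hlt : ∀ x, x ≠ n → g' x = g x := fun x hx => by simp [hg', hx]
      have hgn : g' n = g n * g (n + 1) := by simp [hg']
      have e3 := ih g' (by
        intro i j hij hj
        rw [hlt i (by omega)]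
        by_cases h : j = n
        · subst h
          rw [hgn]
          exact (hc _ _ hij (by omega)).mul_right (hc _ _ (by omega) (by omega))
        · rw [hlt j h]
          exact hc _ _ hij (by omega)) ((u ++ v) ++ [n])
        ((List.Perm.nodup_iff (List.perm_append_singleton n (u ++ v))).2 hl3.of_cons)
        (by
          intro x
          constructor
          · intro hx
            rcases List.mem_append.1 hx with h | h
            · have := huv x h; omega
            · simp at h; omega
          · intro hx
            have := (hm3 x).2 (by omega)
            simp only [List.mem_cons] at this
            rcases this with h | h | h
            · omega
            · simp [h]
            · exact List.mem_append_left _ h)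
      have c1 : (u ++ v).map g' = (u ++ v).map g :=
        List.map_congr_left (fun x hx => hlt x (huv x hx).ne)
      have c2 : (List.range n).map g' = (List.range n).map g :=
        List.map_congr_left (fun x hx => hlt x (List.mem_range.1 hx).ne)
      rw [List.map_append, c1, List.range_succ, List.map_append (l₁ := List.range n), c2] at e3
      rw [List.range_succ, List.range_succ]
      simpa [hgn, mul_assoc] using e3

theorem pc_std {G : Type*} [Group G] (n : ℕ) (g : Fin n → G)
    (h1 : ∀ i, g i ^ 2 = 1)
    (h2 : ∀ i j : Fin n, ((i : ℕ) + 1 < (j : ℕ) ∨ (j : ℕ) + 1 < (i : ℕ)) →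
      (g i * g j) ^ 2 = 1)
    (σ : Equiv.Perm (Fin n)) :
    IsConj (((List.finRange n).map fun i => g (σ i)).prod)
      ((List.range n).map (fun i => if h : i < n then g ⟨i, h⟩ else 1)).prod := by
  have := pc_core n (fun i => if h : i < n then g ⟨i, h⟩ else 1) (by
    intro i j hij hj
    have hi : i < n := by omega
    simp only [hi, hj, dif_pos]
    have a := h1 ⟨i, hi⟩
    have b := h1 ⟨j, hj⟩
    have c := h2 ⟨i, hi⟩ ⟨j, hj⟩ (Or.inl hij)
    rw [pow_two] at a b c
    have a' := inv_eq_of_mul_eq_one_left a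
    have b' := inv_eq_of_mul_eq_one_left b
    have c' := inv_eq_of_mul_eq_one_left c
    rw [mul_inv_rev, a', b'] at c'
    exact c'.symm) ((List.finRange n).map fun i => ((σ i : Fin n) : ℕ))
    ((List.nodup_finRange n).map (Fin.val_injective.comp σ.injective))
    (by
      intro x
      simp only [List.mem_map, List.mem_finRange, true_and]
      constructor
      · rintro ⟨i, rfl⟩; exact (σ i).2
      · intro hx; exact ⟨σ.symm ⟨x, hx⟩, by simp⟩)
  simpa [List.map_map, Function.comp_def] using this


/-- Lemma 3.9 (Hoffman–Humphreys): if generators `g 1, …, g n` of a group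
satisfy `gᵢ² = 1` and `(gᵢ gⱼ)² = 1` whenever `|i - j| > 1`, then for any
permutations `σ, τ` of the indices, the products `g (σ 1) ⋯ g (σ n)` and
`g (τ 1) ⋯ g (τ n)` are conjugate. -/
theorem products_conjugate {G : Type*} [Group G] (n : ℕ) (g : Fin n → G)
    (h1 : ∀ i, g i ^ 2 = 1)
    (h2 : ∀ i j : Fin n, ((i : ℕ) + 1 < (j : ℕ) ∨ (j : ℕ) + 1 < (i : ℕ)) →
      (g i * g j) ^ 2 = 1)
    (σ τ : Equiv.Perm (Fin n)) :
    IsConj (((List.finRange n).map fun i => g (σ i)).prod)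
           (((List.finRange n).map fun i => g (τ i)).prod) := by
  exact (pc_std n g h1 h2 σ).trans (pc_std n g h1 h2 τ).symm
end
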